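/- For all i, j ∈ I, the identity P_{ij} = q^{d_j} t^{−1} · Σ_{u=0}^{N} Σ_{v=0}^{h} c̃_{ij}(u, −v) q^{−u} t^{v} holds in K; equivalently, \overline{P_{ij}} = q^{−d_j} t · Σ_{u=0}^{N} Σ_{v=0}^{h} c̃_{ij}(u, −v) q^{u} t^{−v}. -/

import Mathlib

noncomputable section

open scoped BigOperators

/-- The field `K = ℚ(q,t)` of rational functions in two variables over `ℚ`. -/
abbrev KK : Type := FractionRing (MvPolynomial (Fin 2) ℚ)

/-- The variable `q` of `ℚ(q,t)`. -/
def qv : KK := algebraMap (MvPolynomial (Fin 2) ℚ) KK (MvPolynomial.X 0)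

/-- The variable `t` of `ℚ(q,t)`. -/
def tv : KK := algebraMap (MvPolynomial (Fin 2) ℚ) KK (MvPolynomial.X 1)

/-- The quantum integer `[k]_q = (q^k - q^{-k})/(q - q⁻¹)` in `ℚ(q,t)`. -/
def qint (k : ℤ) : KK := (qv ^ k - qv ^ (-k)) / (qv - qv⁻¹)

variable {I : Type}

/-- The `(q,t)`-deformed Cartan matrix `C(q,t)`:
`C_{ii} = q^{d_i} t⁻¹ + q^{-d_i} t` and `C_{ij} = [c_{ij}]_q` for `i ≠ j`. -/
def Cqt [DecidableEq I] (c : I → I → ℤ) (d : I → ℤ) (i j : I) : KK :=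
  if i = j then qv ^ (d i) * tv⁻¹ + qv ^ (-(d i)) * tv else qint (c i j)

/-- The basis vector `α_i` of `V = K^{⊕I}`. -/
def alphaK [DecidableEq I] (i : I) : I → KK := Pi.single i 1

/-- The deformed bilinear form `B` on `V`, determined by
`B(α_i, α_j) = [d_i]_q C_{ij}(q,t)`. -/
def Bform [Fintype I] [DecidableEq I] (c : I → I → ℤ) (d : I → ℤ)
    (lam mu : I → KK) : KK :=
  ∑ i, ∑ j, lam i * mu j * (qint (d i) * Cqt c d i j)

/-- The operator `T_i : V → V`, `T_i(λ) = λ - (q^{-d_i} t/[d_i]_q)·B(α_i, λ)·α_i`. -/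
def Trefl [Fintype I] [DecidableEq I] (c : I → I → ℤ) (d : I → ℤ) (i : I)
    (lam : I → KK) : I → KK :=
  fun k => lam k - (qv ^ (-(d i)) * tv / qint (d i)) * Bform c d (alphaK i) lam * alphaK i k

/-- The simple reflection `s_i` on the root lattice `ℤ^{⊕I}`, with `s_i(α_j) = α_j - c_{ij} α_i`. -/
def sZ [Fintype I] [DecidableEq I] (c : I → I → ℤ) (i : I) : (I → ℤ) → (I → ℤ) :=
  fun v k => v k - (if k = i then ∑ j, c i j * v j else 0)

/-- The simple root `α_i` of the root lattice `ℤ^{⊕I}`. -/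
def alphaZ [DecidableEq I] (i : I) : I → ℤ := Pi.single i 1

/-- Membership in the Weyl group `W`, the group of automorphisms of the root lattice
generated by the simple reflections; since each simple reflection is an involution,
`W` is exactly the set of finite products of simple reflections. -/
def memW [Fintype I] [DecidableEq I] (c : I → I → ℤ) (w : (I → ℤ) → (I → ℤ)) : Prop :=
  ∃ l : List I, w = (l.map (sZ c)).foldr (· ∘ ·) id

/-- The sum `P_{ij} = Σ_{1 ≤ k ≤ l, i_k = j} B(μ_i, T_{i₁}⋯T_{i_{k-1}}(α_j))` attached to a
reduced word `ww = (i₁, …, i_l)` and chosen deformed fundamental coweights `μ`. -/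
def Pij [Fintype I] [DecidableEq I] (c : I → I → ℤ) (d : I → ℤ) (ww : List I)
    (mu : I → I → KK) (i j : I) : KK :=
  ∑ k : Fin ww.length, if ww.get k = j then
    Bform c d (mu i) ((ww.take k.1).foldr (fun a acc => Trefl c d a acc) (alphaK j)) else 0

/-- The field `ℚ((q))` of formal Laurent series. -/
abbrev FF : Type := LaurentSeries ℚ

/-- The field `ℚ((q))((t⁻¹))` of iterated formal Laurent series: the outer variable is
`s = t⁻¹`, so that Laurent expansion in `t⁻¹` (expansion at `t = ∞`) followed by Laurent
expansion at `q = 0` lands in this field. -/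
abbrev LL : Type := LaurentSeries FF

/-- The image of `q` in `ℚ((q))((t⁻¹))`. -/
def qL : LL := HahnSeries.C (HahnSeries.single (1 : ℤ) (1 : ℚ))

/-- The image of `t` in `ℚ((q))((t⁻¹))`: the inverse `s⁻¹` of the outer variable,
i.e. the monomial with outer exponent `-1`. -/
def tL : LL := HahnSeries.single (-1 : ℤ) (1 : FF)

/-- The coefficient of `q^u t^v` of an element of `ℚ((q))((t⁻¹))` (the coefficient of
`t^v`, i.e. of outer exponent `-v`, is a Laurent series in `q`, of which we take the
coefficient of `q^u`). -/
def dcoeff (x : LL) (u v : ℤ) : ℚ := (x.coeff (-v)).coeff u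

namespace S10

set_option linter.unusedSectionVars false

section part1

variable {I : Type} [Fintype I] [DecidableEq I] {R : Type} [CommRing R]

/-- The renormalised deformed Cartan matrix, polynomial in `p = q⁻¹` and `t`. -/
def En (c : I → I → ℤ) (d : I → ℤ) (p t : R) (i j : I) : R :=
  if i = j then 1 + p ^ (2 * (d i).toNat) * t ^ 2
  else -(t * p ^ ((d j + 1 + c i j).toNat) * ∑ k ∈ Finset.range (-(c i j)).toNat, p ^ (2 * k))

/-- The (deformed) coroot functional. -/
def ct (c : I → I → ℤ) (d : I → ℤ) (p t : R) (i : I) : (I → R) →ₗ[R] R :=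
  ∑ j, En c d p t i j • LinearMap.proj j

/-- The basis vector. -/
def ee (i : I) : I → R := Pi.single i 1

/-- The renormalised deformed reflection. -/
def Th (c : I → I → ℤ) (d : I → ℤ) (p t : R) (i : I) : (I → R) →ₗ[R] (I → R) :=
  LinearMap.id - (ct c d p t i).smulRight (ee i)

/-- The product of deformed reflections along a (reversed) word. -/
def Tl (c : I → I → ℤ) (d : I → ℤ) (p t : R) : List I → ((I → R) →ₗ[R] (I → R))
  | [] => LinearMap.id
  | i :: L => (Tl c d p t L) ∘ₗ (Th c d p t i)

variable (c : I → I → ℤ) (d : I → ℤ) (p t : R)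

lemma ct_apply (i : I) (v : I → R) : ct c d p t i v = ∑ j, En c d p t i j * v j := by
  simp [ct]

lemma ct_ee (i j : I) : ct c d p t i (ee j) = En c d p t i j := by
  simp [ct_apply, ee, Pi.single_apply]

lemma Th_apply (i : I) (v : I → R) :
    Th c d p t i v = v - (ct c d p t i v) • ee i := by
  simp [Th]

lemma Tl_nil (v : I → R) : Tl c d p t [] v = v := rfl

lemma Tl_cons (i : I) (L : List I) (v : I → R) :
    Tl c d p t (i :: L) v = Tl c d p t L (Th c d p t i v) := rfl

lemma Tl_append (L M : List I) (v : I → R) :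
    Tl c d p t (L ++ M) v = Tl c d p t M (Tl c d p t L v) := by
  induction L generalizing v with
  | nil => rfl
  | cons i L ih => simp only [List.cons_append, Tl_cons, ih]

/-- Alternating words. -/
def alt : ℕ → I → I → List I
  | 0, _, _ => []
  | k + 1, i, j => i :: alt k j i

lemma alt_length (k : ℕ) (i j : I) : (alt k i j).length = k := by
  induction k generalizing i j with
  | zero => rfl
  | succ k ih => simp [alt, ih]

/-- Adding a letter at the end of an alternating word. -/
lemma alt_succ_end (k : ℕ) (i j : I) :
    alt (k + 1) i j = alt k i j ++ [if Even k then i else j] := by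
  induction k generalizing i j with
  | zero => simp [alt]
  | succ k ih =>
    rw [alt, ih j i, alt]
    by_cases h : Even k <;> simp [h, Nat.even_add_one]

lemma alt_reverse (k : ℕ) (i j : I) :
    (alt k i j).reverse = if Even k then alt k j i else alt k i j := by
  induction k generalizing i j with
  | zero => simp [alt]
  | succ k ih =>
    rw [alt, List.reverse_cons, ih j i]
    by_cases h : Even k
    · have h' : ¬ Even (k + 1) := by simp [h, Nat.even_add_one]
      have := alt_succ_end k i j
      rw [if_pos h] at this
      rw [if_pos h, if_neg h', ← this, alt]
    · have h' : Even (k + 1) := by simp [h, Nat.even_add_one]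
      have := alt_succ_end k j i
      rw [if_neg h] at this
      rw [if_neg h, if_pos h', ← this]

/-- One step of the rank two computation. -/
lemma step_fst (i j : I) (v : I → R) (x y : R) :
    Th c d p t i (v - x • ee i - y • ee j) =
      v - (x + ct c d p t i v - x * En c d p t i i - y * En c d p t i j) • ee i - y • ee j := by
  rw [Th_apply, map_sub, map_sub, map_smul, map_smul, ct_ee, ct_ee, smul_eq_mul, smul_eq_mul]
  module

lemma step_snd (i j : I) (v : I → R) (x y : R) :
    Th c d p t j (v - x • ee i - y • ee j) =
      v - x • ee i - (y + ct c d p t j v - x * En c d p t j i - y * En c d p t j j) • ee j := by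
  rw [Th_apply, map_sub, map_sub, map_smul, map_smul, ct_ee, ct_ee, smul_eq_mul, smul_eq_mul]
  module

/-- The data of the theorem, bundled. -/
structure Dat (c : I → I → ℤ) (d : I → ℤ) (r : ℤ) : Prop where
  hdiag : ∀ i, c i i = 2
  hoff : ∀ i j, i ≠ j → c i j ≤ 0
  hdpos : ∀ i, 0 < d i
  hsymm : ∀ i j, d i * c i j = d j * c j i
  honer : ∀ i, d i = 1 ∨ d i = r
  hbmax : ∀ i j, i ≠ j → c i j ≠ 0 → d i * c i j = -(max (d i) (d j))
  hWfin : {w : (I → ℤ) → (I → ℤ) | memW c w}.Finite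

/-- The classical Weyl group action along a (reversed) word. -/
abbrev Al (L : List I) : (I → ℤ) →ₗ[ℤ] (I → ℤ) := Tl c d 1 1 L

variable {c d} {r : ℤ}

lemma En_one (D : Dat c d r) (i j : I) : En c d (1 : ℤ) 1 i j = c i j := by
  unfold En
  split_ifs with h
  · subst h; simp [D.hdiag]
  · have := D.hoff i j h
    simp; omega

lemma sZ_eq (D : Dat c d r) (i : I) (v : I → ℤ) : sZ c i v = Th c d (1 : ℤ) 1 i v := by
  funext k
  rw [Th_apply, ct_apply]
  simp only [sZ, En_one D, Pi.sub_apply, Pi.smul_apply, ee, Pi.single_apply, smul_eq_mul]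
  split_ifs <;> simp

lemma foldr_eq (D : Dat c d r) (L : List I) :
    (L.map (sZ c)).foldr (· ∘ ·) id = ⇑(Al c d L.reverse) := by
  induction L with
  | nil => rfl
  | cons i L ih =>
    funext v
    simp only [List.map_cons, List.foldr_cons, ih, List.reverse_cons, Function.comp]
    rw [Al, Tl_append, sZ_eq D]; rfl

lemma memW_iff (D : Dat c d r) (w : (I → ℤ) → (I → ℤ)) :
    memW c w ↔ ∃ L, w = ⇑(Al c d L) := by
  constructor
  · rintro ⟨l, hl⟩; exact ⟨l.reverse, by rw [hl, foldr_eq D]⟩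
  · rintro ⟨l, hl⟩; exact ⟨l.reverse, by rw [hl, foldr_eq D, List.reverse_reverse]⟩

/-- Off-diagonal possibilities. -/
lemma cases2 (D : Dat c d r) {i j : I} (hij : i ≠ j) :
    (c i j = 0 ∧ c j i = 0) ∨ (c i j = -1 ∧ c j i = -1 ∧ d i = d j) ∨
    (d i = 1 ∧ d j = r ∧ c i j = -r ∧ c j i = -1 ∧ 2 ≤ r) ∨
    (d j = 1 ∧ d i = r ∧ c j i = -r ∧ c i j = -1 ∧ 2 ≤ r) := by
  by_cases h0 : c i j = 0
  · left
    refine ⟨h0, ?_⟩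
    have := D.hsymm i j
    rw [h0, mul_zero] at this
    rcases mul_eq_zero.mp this.symm with h | h
    · exact absurd h (D.hdpos j).ne'
    · exact h
  · right
    have h1 : c j i ≠ 0 := by
      intro h
      have := D.hsymm i j
      rw [h, mul_zero] at this
      rcases mul_eq_zero.mp this with h | h
      · exact absurd h (D.hdpos i).ne'
      · exact h0 h
    have e1 := D.hbmax i j hij h0
    have e2 := D.hbmax j i hij.symm h1
    have pi := D.hdpos i
    have pj := D.hdpos j
    by_cases hd : d i = d j
    · left
      rw [hd, max_self] at e1 e2
      refine ⟨?_, ?_, hd⟩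
      · have : d j * (c i j + 1) = 0 := by linarith
        rcases mul_eq_zero.mp this with h | h <;> omega
      · have : d j * (c j i + 1) = 0 := by linarith
        rcases mul_eq_zero.mp this with h | h <;> omega
    · right
      rcases D.honer i with hi | hi <;> rcases D.honer j with hj | hj
      · omega
      · left
        have hr : 2 ≤ r := by omega
        rw [hi, hj, max_eq_right (by omega)] at e1
        rw [hi, hj, max_eq_left (by omega)] at e2
        refine ⟨hi, hj, by linarith, ?_, hr⟩
        have : r * (c j i + 1) = 0 := by linarith
        rcases mul_eq_zero.mp this with h | h <;> omega
      · right
        have hr : 2 ≤ r := by omega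
        rw [hi, hj, max_eq_left (by omega)] at e1
        rw [hi, hj, max_eq_right (by omega)] at e2
        refine ⟨hj, hi, by linarith, ?_, hr⟩
        have : r * (c i j + 1) = 0 := by linarith
        rcases mul_eq_zero.mp this with h | h <;> omega
      · omega

lemma ee_apply (i k : I) : (ee i : I → R) k = if k = i then 1 else 0 := by
  simp [ee, Pi.single_apply]

/-- Finiteness of the Weyl group forces `r ≤ 3` at a multiple edge. -/
lemma r_le (D : Dat c d r) {i j : I} (hij : i ≠ j) (h1 : c i j = -r) (h2 : c j i = -1) :
    r ≤ 3 := by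
  by_contra hr
  push Not at hr
  let f : (I → ℤ) → (I → ℤ) := ⇑(Al c d [j, i])
  have hf : ∀ x y : ℤ, f (x • ee i + y • ee j) =
      ((r - 1) * x - r * y) • ee i + (x - y) • ee j := by
    intro x y
    change Th c d (1:ℤ) 1 i (Th c d (1:ℤ) 1 j (x • ee i + y • ee j)) = _
    have e : x • (ee i : I → ℤ) + y • ee j = 0 - (-x) • ee i - (-y) • ee j := by module
    rw [e, step_snd, step_fst]
    simp only [En_one D, D.hdiag, h1, h2, map_zero]
    module
  have key : ∀ n : ℕ, ∃ x y : ℤ, f^[n] (ee i) = x • ee i + y • ee j ∧ 0 ≤ y ∧ 2 * y < x ∧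
      (n : ℤ) < x := by
    intro n
    induction n with
    | zero => exact ⟨1, 0, by simp, by norm_num, by norm_num, by norm_num⟩
    | succ n ih =>
      obtain ⟨x, y, h, hy, hxy, hn⟩ := ih
      refine ⟨(r - 1) * x - r * y, x - y, ?_, ?_, ?_, ?_⟩
      · rw [Function.iterate_succ_apply', h, hf]
      · omega
      · nlinarith
      · push_cast; nlinarith
  have hmem : ∀ n : ℕ, memW c (f^[n]) := by
    intro n
    rw [memW_iff D]
    induction n with
    | zero => exact ⟨[], rfl⟩
    | succ n ih =>
      obtain ⟨L, hL⟩ := ih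
      refine ⟨L ++ [j, i], ?_⟩
      funext v
      rw [Function.iterate_succ_apply', hL, Al, Tl_append]
  -- the i-th coordinate is unbounded on a finite set
  obtain ⟨B, hB⟩ := (D.hWfin.image (fun w => w (ee i) i)).bddAbove
  obtain ⟨x, y, h, hy, hxy, hn⟩ := key B.toNat
  have := hB ⟨_, hmem B.toNat, rfl⟩
  simp only [h, Pi.add_apply, Pi.smul_apply, ee_apply, if_pos, if_neg hij] at this
  simp at this
  omega

/-- The Coxeter exponent of a pair with all the rank two facts needed. -/
structure Rk2 (c : I → I → ℤ) (d : I → ℤ) (i j : I) (m : ℕ) : Prop where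
  pos : 1 ≤ m
  braid : ∀ {R : Type} [CommRing R] (p t : R) (v : I → R),
    Tl c d p t (alt m i j) v = Tl c d p t (alt m j i) v
  nn1 : ∀ k < m, ∃ a b : ℤ, 0 ≤ a ∧ 0 ≤ b ∧ Al c d (alt k j i) (ee i) = a • ee i + b • ee j
  nn2 : ∀ k < m, ∃ a b : ℤ, 0 ≤ a ∧ 0 ≤ b ∧ Al c d (alt k i j) (ee j) = a • ee i + b • ee j

lemma Rk2.symm {i j : I} {m : ℕ} (h : Rk2 c d i j m) : Rk2 c d j i m := by
  refine ⟨h.pos, fun p t v => (h.braid p t v).symm, fun k hk => ?_, fun k hk => ?_⟩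
  · obtain ⟨a, b, ha, hb, e⟩ := h.nn2 k hk
    exact ⟨b, a, hb, ha, by rw [e, add_comm]⟩
  · obtain ⟨a, b, ha, hb, e⟩ := h.nn1 k hk
    exact ⟨b, a, hb, ha, by rw [e, add_comm]⟩

lemma start (i j : I) (v : I → R) : v = v - (0 : R) • ee i - (0 : R) • ee j := by simp

/-- The rank two recursion. -/
def fn : ℕ → ℤ → ℤ → ℤ → ℤ → ℤ × ℤ
  | 0, _, _, x, y => (x, y)
  | k + 1, A, B, x, y => (fn k B A y (-x - A * y)).swap

lemma fn_spec (D : Dat c d r) (k : ℕ) (i j : I) (x y : ℤ) :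
    Al c d (alt k i j) (x • ee i + y • ee j) =
      (fn k (c i j) (c j i) x y).1 • ee i + (fn k (c i j) (c j i) x y).2 • ee j := by
  induction k generalizing i j x y with
  | zero => rfl
  | succ k ih =>
    have e : Th c d (1:ℤ) 1 i (x • ee i + y • ee j) =
        y • ee j + (-x - c i j * y) • ee i := by
      have e : x • (ee i : I → ℤ) + y • ee j = 0 - (-x) • ee i - (-y) • ee j := by module
      rw [e, step_fst]
      simp only [En_one D, D.hdiag, map_zero]
      module
    rw [alt, Al, Tl_cons, e]
    refine (ih j i _ _).trans ?_
    rw [add_comm]; rfl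

lemma nn_of_fn (D : Dat c d r) (m : ℕ) (i j : I)
    (h : ∀ k < m, 0 ≤ (fn k (c i j) (c j i) 0 1).1 ∧ 0 ≤ (fn k (c i j) (c j i) 0 1).2) :
    ∀ k < m, ∃ a b : ℤ, 0 ≤ a ∧ 0 ≤ b ∧ Al c d (alt k i j) (ee j) = a • ee i + b • ee j := by
  intro k hk
  refine ⟨_, _, (h k hk).1, (h k hk).2, ?_⟩
  rw [← fn_spec D]; simp

lemma mk_rk2 (D : Dat c d r) (m : ℕ) (hm : 1 ≤ m) (i j : I)
    (h1 : ∀ k < m, 0 ≤ (fn k (c i j) (c j i) 0 1).1 ∧ 0 ≤ (fn k (c i j) (c j i) 0 1).2)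
    (h2 : ∀ k < m, 0 ≤ (fn k (c j i) (c i j) 0 1).1 ∧ 0 ≤ (fn k (c j i) (c i j) 0 1).2)
    (hb : ∀ {R : Type} [CommRing R] (p t : R) (v : I → R),
    Tl c d p t (alt m i j) v = Tl c d p t (alt m j i) v) : Rk2 c d i j m := by
  refine ⟨hm, hb, ?_, nn_of_fn D m i j h1⟩
  intro k hk
  obtain ⟨a, b, ha, hb, e⟩ := nn_of_fn D m j i h2 k hk
  exact ⟨b, a, hb, ha, by rw [e, add_comm]⟩

lemma En_self (p t : R) (i : I) : En c d p t i i = 1 + p ^ (2 * (d i).toNat) * t ^ 2 := by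
  simp [En]

lemma En_ne (p t : R) {i j : I} (h : i ≠ j) : En c d p t i j =
    -(t * p ^ ((d j + 1 + c i j).toNat) * ∑ k ∈ Finset.range (-(c i j)).toNat, p ^ (2 * k)) := by
  simp [En, h]

lemma braid_congr (i j : I) (v : I → R) {x y x' y' : R} (hx : x = x') (hy : y = y') :
    v - x • ee i - y • ee j = v - x' • ee i - y' • ee j := by rw [hx, hy]

lemma rk2_mult (D : Dat c d r) {i j : I} (hij : i ≠ j) (h1 : d i = 1) (h2 : d j = r)
    (h3 : c i j = -r) (h4 : c j i = -1) (hr : 2 ≤ r) : ∃ m, Rk2 c d i j m := by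
  have hr3 := r_le D hij h3 h4
  obtain rfl | rfl : r = 2 ∨ r = 3 := by omega
  · refine ⟨4, mk_rk2 D 4 (by norm_num) i j ?_ ?_ ?_⟩
    · rw [h3, h4]; decide
    · rw [h3, h4]; decide
    · intro R _ p t v
      simp only [alt, Tl_cons, Tl_nil]
      rw [start i j v]
      simp only [step_fst, step_snd]
      rw [En_self, En_self, En_ne p t hij, En_ne p t hij.symm, h1, h2, h3, h4]
      generalize ct c d p t i _ = a
      generalize ct c d p t j _ = b
      simp [Finset.sum_range_succ]
      apply braid_congr <;> ring
  · refine ⟨6, mk_rk2 D 6 (by norm_num) i j ?_ ?_ ?_⟩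
    · rw [h3, h4]; decide
    · rw [h3, h4]; decide
    · intro R _ p t v
      simp only [alt, Tl_cons, Tl_nil]
      rw [start i j v]
      simp only [step_fst, step_snd]
      rw [En_self, En_self, En_ne p t hij, En_ne p t hij.symm, h1, h2, h3, h4]
      generalize ct c d p t i _ = a
      generalize ct c d p t j _ = b
      simp [Finset.sum_range_succ]
      apply braid_congr <;> ring

/-- Every pair of distinct indices has a Coxeter exponent. -/
lemma rk2 (D : Dat c d r) {i j : I} (hij : i ≠ j) : ∃ m, Rk2 c d i j m := by
  rcases cases2 D hij with ⟨h1, h2⟩ | ⟨h1, h2, h3⟩ | ⟨h1, h2, h3, h4, hr⟩ | ⟨h1, h2, h3, h4, hr⟩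
  · refine ⟨2, mk_rk2 D 2 (by norm_num) i j ?_ ?_ ?_⟩
    · rw [h1, h2]; decide
    · rw [h1, h2]; decide
    · intro R _ p t v
      simp only [alt, Tl_cons, Tl_nil]
      rw [start i j v]
      simp only [step_fst, step_snd]
      rw [En_ne p t hij, En_ne p t hij.symm, h1, h2]
      simp
  · refine ⟨3, mk_rk2 D 3 (by norm_num) i j ?_ ?_ ?_⟩
    · rw [h1, h2]; decide
    · rw [h1, h2]; decide
    · intro R _ p t v
      simp only [alt, Tl_cons, Tl_nil]
      rw [start i j v]
      simp only [step_fst, step_snd]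
      rw [En_self, En_self, En_ne p t hij, En_ne p t hij.symm, h1, h2, h3]
      generalize ct c d p t i _ = a
      generalize ct c d p t j _ = b
      simp
      apply braid_congr <;> ring
  · exact rk2_mult D hij h1 h2 h3 h4 hr
  · obtain ⟨m, hm⟩ := rk2_mult D hij.symm h1 h2 h3 h4 hr
    exact ⟨m, hm.symm⟩

end part1
end S10

namespace S10

set_option linter.unusedSectionVars false

section part2

variable {I : Type} [Fintype I] [DecidableEq I] {R : Type} [CommRing R]
variable {c : I → I → ℤ} {d : I → ℤ} {r : ℤ}

/-- Nonnegative vectors. -/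
def Pos (v : I → ℤ) : Prop := ∀ k, 0 ≤ v k

/-- Reduced words. -/
def Red (c : I → I → ℤ) (d : I → ℤ) (L : List I) : Prop :=
  ∀ L' : List I, Al c d L' = Al c d L → L.length ≤ L'.length

/-- Right descents (words are reversed). -/
def Desc (c : I → I → ℤ) (d : I → ℤ) (L : List I) (i : I) : Prop :=
  ∃ L' : List I, L'.length + 1 = L.length ∧ Al c d (i :: L') = Al c d L

lemma ss (D : Dat c d r) (i : I) (v : I → ℤ) :
    Th c d (1 : ℤ) 1 i (Th c d 1 1 i v) = v := by
  simp only [Th_apply, map_sub, map_smul, ct_ee, En_one D, D.hdiag]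
  module

lemma s_self (D : Dat c d r) (i : I) : Th c d (1 : ℤ) 1 i (ee i) = - ee i := by
  simp only [Th_apply, ct_ee, En_one D, D.hdiag]
  module

lemma Al_cons (i : I) (L : List I) (v : I → ℤ) :
    Al c d (i :: L) v = Al c d L (Th c d 1 1 i v) := rfl

lemma Al_append (L M : List I) (v : I → ℤ) :
    Al c d (L ++ M) v = Al c d M (Al c d L v) := Tl_append ..

lemma Al_cons_congr {L M : List I} (i : I) (h : Al c d L = Al c d M) :
    Al c d (i :: L) = Al c d (i :: M) := by
  apply LinearMap.ext; intro v; rw [Al_cons, Al_cons, h]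

lemma Al_append_congr {L M : List I} (P : List I) (h : Al c d L = Al c d M) :
    Al c d (P ++ L) = Al c d (P ++ M) := by
  apply LinearMap.ext; intro v; rw [Al_append, Al_append, h]

lemma Al_cons_cancel (D : Dat c d r) {L M : List I} (i : I)
    (h : Al c d (i :: L) = Al c d (i :: M)) : Al c d L = Al c d M := by
  apply LinearMap.ext; intro v
  have := congrArg (fun f => f (Th c d 1 1 i v)) h
  simpa [Al_cons, ss D] using this

lemma Al_cons_cons (D : Dat c d r) (i : I) (L : List I) :
    Al c d (i :: i :: L) = Al c d L := by
  apply LinearMap.ext; intro v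
  rw [Al_cons, Al_cons, ss D]

lemma Al_reverse (D : Dat c d r) (L : List I) (v : I → ℤ) :
    Al c d L.reverse (Al c d L v) = v := by
  induction L generalizing v with
  | nil => rfl
  | cons i L ih =>
    rw [List.reverse_cons, Al_append, Al_cons i L, ih]
    exact ss D i v

lemma Al_reverse' (D : Dat c d r) (L : List I) (v : I → ℤ) :
    Al c d L (Al c d L.reverse v) = v := by
  simpa using Al_reverse D L.reverse v

lemma Red.tail {i : I} {L : List I} (h : Red c d (i :: L)) : Red c d L := by
  intro L' e
  have := h (i :: L') (Al_cons_congr i e)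
  simpa using this

lemma Red.suffix {P L : List I} (h : Red c d (P ++ L)) : Red c d L := by
  induction P with
  | nil => exact h
  | cons i P ih => exact ih (Red.tail h)

lemma Red.of_eq {L M : List I} (h : Red c d L) (e : Al c d M = Al c d L)
    (hl : M.length = L.length) : Red c d M := by
  intro L' e'
  rw [hl]; exact h L' (e'.trans e)

lemma Red.not_desc (D : Dat c d r) {i : I} {L : List I} (h : Red c d (i :: L)) :
    ¬ Desc c d L i := by
  rintro ⟨L', hl, e⟩
  have := h L' (by rw [← Al_cons_cons D i L']; exact Al_cons_congr i e)
  simp at this; omega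

lemma exists_red (D : Dat c d r) (L : List I) : ∃ M, Red c d M ∧ Al c d M = Al c d L := by
  classical
  have hex : ∃ n, ∃ M : List I, M.length = n ∧ Al c d M = Al c d L := ⟨_, L, rfl, rfl⟩
  obtain ⟨M, hM, e⟩ := Nat.find_spec hex
  refine ⟨M, ?_, e⟩
  intro L' e'
  rw [hM]
  exact Nat.find_min' hex ⟨L', rfl, e'.trans e⟩

lemma Pos.comb {u v : I → ℤ} (hu : Pos u) (hv : Pos v) {a b : ℤ} (ha : 0 ≤ a) (hb : 0 ≤ b) :
    Pos (a • u + b • v) := by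
  intro k
  have h1 := hu k
  have h2 := hv k
  simp only [Pi.add_apply, Pi.smul_apply, smul_eq_mul]
  positivity

/-- The fundamental positivity dichotomy. -/
lemma pos_or_desc (D : Dat c d r) : ∀ (n : ℕ) (L : List I), L.length = n → Red c d L → ∀ i,
    Pos (Al c d L (ee i)) ∨ Desc c d L i := by
  intro n
  induction n using Nat.strong_induction_on with
  | _ n IH =>
  intro L hL hred i
  rcases L with _ | ⟨j, L1⟩
  · left
    intro k
    change (0:ℤ) ≤ (ee i : I → ℤ) k
    rw [ee_apply]; split_ifs <;> norm_num
  by_cases hij : i = j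
  · subst hij
    right; exact ⟨L1, by simp, rfl⟩
  obtain ⟨m, hm⟩ := rk2 D hij
  have hpos := hm.pos
  -- go down the dihedral coset
  have key : ∀ k, k ≤ m → (Pos (Al c d (j :: L1) (ee i)) ∨ Desc c d (j :: L1) i) ∨
      ∃ Lk : List I, Lk.length + k = n ∧ Al c d (alt k j i ++ Lk) = Al c d (j :: L1) := by
    intro k
    induction k with
    | zero => intro _; right; exact ⟨j :: L1, by simpa using hL, rfl⟩
    | succ k ihk =>
      intro hk
      rcases ihk (by omega) with h | ⟨Lk, hlk, e⟩
      · exact Or.inl h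
      rcases Nat.eq_zero_or_pos k with rfl | hk0
      · right; exact ⟨L1, by simpa using hL, rfl⟩
      have hredk : Red c d (alt k j i ++ Lk) := hred.of_eq e (by
        rw [List.length_append, alt_length, hL]; omega)
      have hredL : Red c d Lk := hredk.suffix
      obtain ⟨k', rfl⟩ : ∃ k', k = k' + 1 := ⟨k - 1, by omega⟩
      -- the last stripped letter
      have hx : Pos (Al c d Lk (ee (if Even k' then j else i))) := by
        rcases IH Lk.length (by omega) Lk rfl hredL (if Even k' then j else i) with h | h
        · exact h
        · exfalso
          refine Red.not_desc D ?_ h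
          rw [alt_succ_end, List.append_assoc] at hredk
          exact hredk.suffix
      rcases IH Lk.length (by omega) Lk rfl hredL (if Even k' then i else j) with h | h
      · left; left
        obtain ⟨a, b, ha, hb, e2⟩ := hm.nn1 (k' + 1) (by omega)
        rw [← e, Al_append, e2, map_add, map_smul, map_smul]
        by_cases hev : Even k'
        · simp only [hev, if_true] at h hx
          exact h.comb hx ha hb
        · simp only [hev, if_false] at h hx
          exact hx.comb h ha hb
      · right
        obtain ⟨L', hl', e'⟩ := h
        refine ⟨L', by omega, ?_⟩
        rw [alt_succ_end, List.append_assoc, ← e]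
        apply Al_append_congr
        rw [← e']
        by_cases hev : Even k'
        · have : ¬ Even (k' + 1) := by simp [hev, Nat.even_add_one]
          simp [hev, this]
        · have : Even (k' + 1) := by simp [hev, Nat.even_add_one]
          simp [hev, this]
  rcases key m le_rfl with h | ⟨Lm, hlm, e⟩
  · exact h
  right
  obtain ⟨m', rfl⟩ : ∃ m', m = m' + 1 := ⟨m - 1, by omega⟩
  refine ⟨alt m' j i ++ Lm, ?_, ?_⟩
  · rw [List.length_append, alt_length, hL]; omega
  · rw [← e]
    apply LinearMap.ext; intro v
    rw [Al_append, ← hm.braid, ← Al_append]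
    rfl

lemma Red.pos_or_desc (D : Dat c d r) {L : List I} (h : Red c d L) (i : I) :
    Pos (Al c d L (ee i)) ∨ Desc c d L i := S10.pos_or_desc D _ L rfl h i

lemma Red.pos_tail (D : Dat c d r) {L : List I} {i : I} (h : Red c d (i :: L)) :
    Pos (Al c d L (ee i)) := by
  rcases h.tail.pos_or_desc D i with h1 | h1
  · exact h1
  · exact absurd h1 (h.not_desc D)

lemma Red.neg_head (D : Dat c d r) {L : List I} {i : I} (h : Red c d (i :: L)) :
    Pos (-(Al c d (i :: L) (ee i))) := by
  rw [Al_cons, s_self D, map_neg, neg_neg]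
  exact h.pos_tail D

lemma Al_ne_zero (D : Dat c d r) (L : List I) (i : I) : Al c d L (ee i) ≠ 0 := by
  intro h
  have := Al_reverse D L (ee i)
  rw [h, map_zero] at this
  have := congrFun this i
  simp [ee_apply] at this

lemma not_pos_neg {v : I → ℤ} (hv : v ≠ 0) (h : Pos v) (h' : Pos (-v)) : False := by
  apply hv
  funext k
  have h1 := h k
  have h2 := h' k
  simp only [Pi.neg_apply] at h2
  simp only [Pi.zero_apply]
  omega

/-- Roots are positive or negative. -/
lemma root_sign (D : Dat c d r) (L : List I) (i : I) :
    Pos (Al c d L (ee i)) ∨ Pos (-(Al c d L (ee i))) := by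
  obtain ⟨M, hM, e⟩ := exists_red D L
  rw [← e]
  rcases hM.pos_or_desc D i with h | ⟨L', hl, e'⟩
  · exact Or.inl h
  · right
    rw [← e']
    exact (hM.of_eq e' (by simpa using hl)).neg_head D

/-- If both `i` and `j` are descents then the whole dihedral longest word can be stripped. -/
lemma strip (D : Dat c d r) {i j : I} {m : ℕ} (hm : Rk2 c d i j m) {L : List I}
    (hred : Red c d L) (hi : Pos (-(Al c d L (ee i)))) (hj : Pos (-(Al c d L (ee j)))) :
    ∀ k, k ≤ m → ∃ Lk : List I, Lk.length + k = L.length ∧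
      Al c d (alt k i j ++ Lk) = Al c d L := by
  intro k
  induction k with
  | zero => intro _; exact ⟨L, by simp, rfl⟩
  | succ k ih =>
    intro hk
    obtain ⟨Lk, hlk, e⟩ := ih (by omega)
    have hredk : Red c d Lk :=
      (hred.of_eq e (by rw [List.length_append, alt_length]; omega)).suffix
    have hAl : ∀ v, Al c d Lk v = Al c d L (Al c d (alt k i j).reverse v) := by
      intro v
      rw [← e, Al_append, Al_reverse' D]
    have hdesc : Desc c d Lk (if Even k then i else j) := by
      rcases hredk.pos_or_desc D (if Even k then i else j) with h | h
      · exfalso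
        refine not_pos_neg (Al_ne_zero D Lk _) h ?_
        rw [hAl, alt_reverse]
        obtain ⟨a, b, ha, hb, e2⟩ : ∃ a b : ℤ, 0 ≤ a ∧ 0 ≤ b ∧
            Al c d (if Even k then alt k j i else alt k i j) (ee (if Even k then i else j)) =
            a • ee i + b • ee j := by
          by_cases hev : Even k
          · simp only [hev, if_true]; exact hm.nn1 k (by omega)
          · simp only [hev, if_false]; exact hm.nn2 k (by omega)
        rw [e2, map_add, map_smul, map_smul, neg_add, ← smul_neg, ← smul_neg]
        exact hi.comb hj ha hb
      · exact h
    obtain ⟨L', hl', e'⟩ := hdesc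
    refine ⟨L', by omega, ?_⟩
    rw [alt_succ_end, List.append_assoc, ← e]
    apply Al_append_congr
    have efinal := e'
    exact efinal

/-- The Matsumoto theorem for the deformed reflections. -/
lemma matsumoto (D : Dat c d r) (p t : R) : ∀ (n : ℕ) (L M : List I), L.length = n →
    M.length = n → Red c d L → Al c d L = Al c d M → ∀ v, Tl c d p t L v = Tl c d p t M v := by
  intro n
  induction n with
  | zero =>
    intro L M hL hM _ _ v
    rw [List.length_eq_zero_iff] at hL hM
    subst hL hM; rfl
  | succ n IH =>
    have same : ∀ (i : I) (L M : List I), L.length = n → M.length = n → Red c d (i :: L) →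
        Al c d (i :: L) = Al c d (i :: M) →
        ∀ v, Tl c d p t (i :: L) v = Tl c d p t (i :: M) v := by
      intro i L M hL hM hr e v
      rw [Tl_cons, Tl_cons]
      exact IH L M hL hM hr.tail (Al_cons_cancel D i e) _
    intro L M hL hM hr e v
    rcases L with _ | ⟨i, L⟩
    · simp at hL
    rcases M with _ | ⟨j, M⟩
    · simp at hM
    have hr' : Red c d (j :: M) := hr.of_eq e.symm (by rw [hL, hM])
    have hL' : L.length = n := by simpa using hL
    have hM' : M.length = n := by simpa using hM
    by_cases hij : i = j
    · subst hij; exact same i L M hL' hM' hr e v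
    obtain ⟨m, hm⟩ := rk2 D hij
    have hi := hr.neg_head D
    have hj := hr'.neg_head D
    rw [← e] at hj
    obtain ⟨Lm, hlm, em⟩ := strip D hm hr hi hj m le_rfl
    have hpos := hm.pos
    obtain ⟨m', rfl⟩ : ∃ m', m = m' + 1 := ⟨m - 1, by omega⟩
    have em' : Al c d (alt (m' + 1) j i ++ Lm) = Al c d (i :: L) := by
      rw [← em]
      apply LinearMap.ext; intro v
      rw [Al_append, Al_append, ← hm.braid]
    have h1 : Tl c d p t (i :: L) v = Tl c d p t (alt (m' + 1) i j ++ Lm) v :=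
      same i L (alt m' j i ++ Lm) hL' (by rw [List.length_append, alt_length]; omega) hr em.symm v
    have h2 : Tl c d p t (j :: M) v = Tl c d p t (alt (m' + 1) j i ++ Lm) v :=
      same j M (alt m' i j ++ Lm) hM' (by rw [List.length_append, alt_length]; omega) hr'
        (e.symm.trans em'.symm) v
    rw [h1, h2, Tl_append, Tl_append, hm.braid]

lemma Red.reverse (D : Dat c d r) {L : List I} (h : Red c d L) : Red c d L.reverse := by
  intro L' e
  have := h L'.reverse (by
    apply LinearMap.ext; intro v
    have h1 : Al c d L' (Al c d L'.reverse v) = v := Al_reverse' D L' v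
    rw [e] at h1
    have := congrArg (Al c d L) h1
    rw [Al_reverse' D] at this
    exact this)
  simpa using this

end part2
end S10

namespace S10

set_option linter.unusedSectionVars false

section part3

variable {I : Type} [Fintype I] [DecidableEq I] {R : Type} [CommRing R]
variable {c : I → I → ℤ} {d : I → ℤ} {r : ℤ}

/-- The invariant symmetric form on the root lattice. -/
def bil (c : I → I → ℤ) (d : I → ℤ) : (I → ℤ) →ₗ[ℤ] ((I → ℤ) →ₗ[ℤ] ℤ) :=
  ∑ i, d i • LinearMap.smulRight (LinearMap.proj i) (ct c d (1 : ℤ) 1 i)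

lemma bil_apply (x y : I → ℤ) :
    bil c d x y = ∑ i, d i * (x i * ct c d (1 : ℤ) 1 i y) := by
  simp [bil]

lemma bil_ee (i : I) (y : I → ℤ) : bil c d (ee i) y = d i * ct c d (1 : ℤ) 1 i y := by
  simp [bil_apply, ee_apply]

lemma bil_symm (D : Dat c d r) (x y : I → ℤ) : bil c d x y = bil c d y x := by
  simp only [bil_apply, ct_apply, En_one D, Finset.mul_sum]
  rw [Finset.sum_comm]
  refine Finset.sum_congr rfl fun i _ => Finset.sum_congr rfl fun j _ => ?_
  have := D.hsymm i j
  linear_combination (- x j * y i) * this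

lemma bil_s (D : Dat c d r) (i : I) (x y : I → ℤ) :
    bil c d (Th c d 1 1 i x) (Th c d 1 1 i y) = bil c d x y := by
  have e1 : bil c d x (ee i) = d i * ct c d (1 : ℤ) 1 i x := by rw [bil_symm D, bil_ee]
  simp only [Th_apply, map_sub, map_smul, LinearMap.sub_apply, LinearMap.smul_apply, e1, bil_ee,
    ct_ee, En_one D, D.hdiag, smul_eq_mul]
  ring

lemma bil_Al (D : Dat c d r) (L : List I) (x y : I → ℤ) :
    bil c d (Al c d L x) (Al c d L y) = bil c d x y := by
  induction L generalizing x y with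
  | nil => rfl
  | cons i L ih => rw [Al_cons, Al_cons, ih, bil_s D]

lemma bil_ee_ee (D : Dat c d r) (i j : I) : bil c d (ee i) (ee j) = d i * c i j := by
  rw [bil_ee, ct_ee, En_one D]

/-- The longest element data. -/
structure W0 (c : I → I → ℤ) (d : I → ℤ) (RW : List I) (star : I → I) : Prop where
  red : Red c d RW
  st : ∀ i, Al c d RW (ee i) = - ee (star i)
  inv : Function.Involutive star

variable {RW : List I} {star : I → I}

lemma W0.dstar (W : W0 c d RW star) (D : Dat c d r) (i : I) : d (star i) = d i := by
  have h := bil_Al D RW (ee i) (ee i)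
  rw [W.st, map_neg, map_neg, LinearMap.neg_apply, neg_neg, bil_ee_ee D, bil_ee_ee D,
    D.hdiag, D.hdiag] at h
  omega

lemma W0.cstar (W : W0 c d RW star) (D : Dat c d r) (i j : I) :
    c (star i) (star j) = c i j := by
  have h := bil_Al D RW (ee i) (ee j)
  rw [W.st, W.st, map_neg, map_neg, LinearMap.neg_apply, neg_neg, bil_ee_ee D, bil_ee_ee D,
    W.dstar D] at h
  exact mul_left_cancel₀ (D.hdpos i).ne' h

lemma W0.Enstar (W : W0 c d RW star) (D : Dat c d r) (p t : R) (i j : I) :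
    En c d p t (star i) (star j) = En c d p t i j := by
  unfold En
  rw [W.cstar D, W.dstar D, W.dstar D]
  simp [W.inv.injective.eq_iff]

/-- A vector is the sum of its coordinates. -/
lemma vec_sum (v : I → R) : v = ∑ j, v j • ee j := by
  funext k; simp [ee_apply]

lemma W0.Al_eq (W : W0 c d RW star) (v : I → ℤ) (k : I) :
    Al c d RW v k = - v (star k) := by
  conv_lhs => rw [vec_sum v]
  rw [map_sum]
  simp only [map_smul, W.st, Finset.sum_apply, Pi.smul_apply, Pi.neg_apply, ee_apply, smul_eq_mul]
  have : ∀ x, (k = star x) ↔ (star k = x) := fun x =>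
    ⟨fun h => by rw [h, W.inv], fun h => by rw [← h, W.inv]⟩
  simp [this]

lemma W0.ct_star (W : W0 c d RW star) (D : Dat c d r) (i : I) (v : I → ℤ) :
    ct c d (1:ℤ) 1 (star i) (Al c d RW v) = - ct c d (1:ℤ) 1 i v := by
  rw [ct_apply, ct_apply, ← Equiv.sum_comp (Equiv.ofBijective star W.inv.bijective),
    ← Finset.sum_neg_distrib]
  refine Finset.sum_congr rfl fun j _ => ?_
  rw [Equiv.ofBijective_apply, W.Enstar D, W.Al_eq, W.inv]; ring

lemma W0.s_comm (W : W0 c d RW star) (D : Dat c d r) (i : I) (v : I → ℤ) :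
    Th c d 1 1 (star i) (Al c d RW v) = Al c d RW (Th c d 1 1 i v) := by
  rw [Th_apply, W.ct_star D, Th_apply, map_sub, map_smul, W.st]
  module

/-- The deformed longest element intertwines the reflections. -/
lemma W0.comm (W : W0 c d RW star) (D : Dat c d r) (p t : R) (i : I) (v : I → R) :
    Tl c d p t RW (Th c d p t i v) = Th c d p t (star i) (Tl c d p t RW v) := by
  have hdesc : Desc c d RW i := by
    rcases W.red.pos_or_desc D i with h | h
    · exfalso
      have := h (star i)
      rw [W.st] at this
      simp [ee_apply] at this
    · exact h
  obtain ⟨L', hl, e⟩ := hdesc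
  have e2 : Al c d RW = Al c d (L' ++ [star i]) := by
    apply LinearMap.ext; intro u
    have h1 : Al c d L' u = Al c d RW (Th c d 1 1 i u) := by rw [← e, Al_cons, ss D]
    rw [Al_append]
    change _ = Th c d 1 1 (star i) (Al c d L' u)
    rw [h1, W.s_comm D, ss D]
  have m1 := matsumoto D p t RW.length RW (i :: L') rfl (by simpa using hl) W.red e.symm
  have m2 := matsumoto D p t RW.length RW (L' ++ [star i]) rfl (by simpa using hl) W.red e2
  rw [m2, m1 v, Tl_append, Tl_cons]
  rfl

lemma Tl_map {S : Type} [CommRing S] (f : R →+* S) (p t : R) (L : List I) (v : I → R) :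
    Tl c d (f p) (f t) L (fun k => f (v k)) = fun k => f (Tl c d p t L v k) := by
  have hE : ∀ i j, f (En c d p t i j) = En c d (f p) (f t) i j := by
    intro i j; unfold En; split_ifs <;> simp
  induction L generalizing v with
  | nil => rfl
  | cons i L ih =>
    rw [Tl_cons, Tl_cons, ← ih]
    congr 1
    funext k
    simp only [Th_apply, ct_apply, Pi.sub_apply, Pi.smul_apply, smul_eq_mul, map_sub, map_mul,
      map_sum, hE, ee_apply]
    split_ifs <;> simp

lemma En_map {S : Type} [CommRing S] (f : R →+* S) (p t : R) (i j : I) :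
    f (En c d p t i j) = En c d (f p) (f t) i j := by
  unfold En; split_ifs <;> simp

/-- Schur's lemma. -/
lemma W0.schur [IsDomain R] [Nonempty I] (W : W0 c d RW star) (D : Dat c d r) (p t : R)
    (hconn : ∀ i j : I, Relation.ReflTransGen (fun a b => a ≠ b ∧ c a b ≠ 0) i j)
    (h1 : ∀ i, 1 + p ^ (2 * (d i).toNat) * t ^ 2 ≠ 0)
    (h2 : ∀ i j, i ≠ j → c i j ≠ 0 → En c d p t i j ≠ 0) :
    ∃ x : R, ∀ v k, Tl c d p t RW v k = x * v (star k) := by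
  have hx : ∀ i, Tl c d p t RW (ee i) = (Tl c d p t RW (ee i) (star i)) • ee (star i) := by
    intro i
    have hs : Th c d p t i (ee i) = (-(p ^ (2 * (d i).toNat) * t ^ 2)) • ee i := by
      rw [Th_apply, ct_ee, En_self]; module
    have h := W.comm D p t i (ee i)
    rw [hs, map_smul] at h
    funext k
    by_cases hk : k = star i
    · subst hk; simp [ee_apply]
    · have := congrFun h k
      rw [Th_apply] at this
      simp only [Pi.smul_apply, Pi.sub_apply, ee_apply, if_neg hk, smul_eq_mul, mul_zero,
        sub_zero] at this ⊢
      have h0 : (1 + p ^ (2 * (d i).toNat) * t ^ 2) * Tl c d p t RW (ee i) k = 0 := by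
        linear_combination -this
      exact (mul_eq_zero.mp h0).resolve_left (h1 i)
  have hadj : ∀ i j, i ≠ j ∧ c i j ≠ 0 →
      Tl c d p t RW (ee i) (star i) = Tl c d p t RW (ee j) (star j) := by
    rintro i j ⟨hij, hc⟩
    have h := W.comm D p t i (ee j)
    have hne : star i ≠ star j := fun h => hij (W.inv.injective h)
    rw [Th_apply, Th_apply, map_sub, map_smul, ct_ee, hx j, map_smul, ct_ee, W.Enstar D] at h
    have := congrFun h (star i)
    simp only [Pi.sub_apply, Pi.smul_apply, ee_apply, if_neg hne, smul_eq_mul, mul_zero, mul_one,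
      if_true, zero_sub, neg_inj] at this
    have h3 : En c d p t i j * (Tl c d p t RW (ee i) (star i) - Tl c d p t RW (ee j) (star j))
        = 0 := by linear_combination this
    exact sub_eq_zero.mp ((mul_eq_zero.mp h3).resolve_left (h2 i j hij hc))
  have hall : ∀ i j, Tl c d p t RW (ee i) (star i) = Tl c d p t RW (ee j) (star j) := by
    intro i j
    induction hconn i j with
    | refl => rfl
    | tail _ h ih => exact ih.trans (hadj _ _ h)
  obtain ⟨i0⟩ := ‹Nonempty I›
  refine ⟨Tl c d p t RW (ee i0) (star i0), fun v k => ?_⟩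
  conv_lhs => rw [vec_sum v]
  rw [map_sum]
  have : ∀ x, (k = star x) ↔ (star k = x) := fun x =>
    ⟨fun h => by rw [h, W.inv], fun h => by rw [← h, W.inv]⟩
  have h4 : ∀ j, Tl c d p t RW (v j • ee j) k =
      v j * (Tl c d p t RW (ee i0) (star i0) * if k = star j then 1 else 0) := by
    intro j
    rw [map_smul, hx j, hall j i0]
    simp [ee_apply]
  rw [Finset.sum_apply, Finset.sum_congr rfl fun j _ => h4 j]
  simp [this, mul_comm]

/-- Every monomial multiple is in the image of a deformed product. -/
lemma Tl_surj (p t : R) (L : List I) : ∃ a b : ℕ, ∀ v : I → R, ∃ u,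
    Tl c d p t L u = (p ^ a * t ^ b) • v := by
  induction L with
  | nil => exact ⟨0, 0, fun v => ⟨v, by simp [Tl_nil]⟩⟩
  | cons i L ih =>
    obtain ⟨a, b, h⟩ := ih
    refine ⟨2 * (d i).toNat + a, 2 + b, fun v => ?_⟩
    obtain ⟨u, hu⟩ := h v
    refine ⟨Th c d p t i u - u + (p ^ (2 * (d i).toNat) * t ^ 2) • u, ?_⟩
    have e : Th c d p t i (Th c d p t i u - u + (p ^ (2 * (d i).toNat) * t ^ 2) • u) =
        (p ^ (2 * (d i).toNat) * t ^ 2) • u := by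
      simp only [Th_apply, map_sub, map_add, map_smul, ct_ee, En_self]
      module
    rw [Tl_cons, e, map_smul, hu, smul_smul]
    congr 1; ring

/-- The polynomial ring `ℚ[p,t]`. -/
abbrev AA : Type := MvPolynomial (Fin 2) ℚ

lemma dvd_monomial (x : AA) (a b : ℕ) (h : x ∣ MvPolynomial.X 0 ^ a * MvPolynomial.X 1 ^ b) :
    ∃ (k : ℚ) (a' b' : ℕ), x = MvPolynomial.C k * MvPolynomial.X 0 ^ a' *
      MvPolynomial.X 1 ^ b' := by
  obtain ⟨y, z, hy, hz, rfl⟩ := exists_dvd_and_dvd_of_dvd_mul h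
  obtain ⟨a', _, ha⟩ := (dvd_prime_pow (MvPolynomial.X_prime (i := 0)) a).mp hy
  obtain ⟨b', _, hb⟩ := (dvd_prime_pow (MvPolynomial.X_prime (i := 1)) b).mp hz
  obtain ⟨u, hu⟩ := ha.symm
  obtain ⟨w, hw⟩ := hb.symm
  obtain ⟨k, hk⟩ : ∃ k, (↑(u * w) : AA) = MvPolynomial.C k := by
    have := MvPolynomial.isUnit_iff_eq_C_of_isReduced.mp (u * w).isUnit
    obtain ⟨k, _, hk⟩ := this
    exact ⟨k, hk⟩
  refine ⟨k, a', b', ?_⟩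
  rw [← hk, ← hu, ← hw]
  push_cast; ring

lemma En_AA_ne (D : Dat c d r) (i j : I) (hc : c i j ≠ 0) :
    En c d (MvPolynomial.X 0 : AA) (MvPolynomial.X 1) i j ≠ 0 := by
  intro h
  have h' := congrArg (MvPolynomial.eval (fun _ => (1:ℚ))) h
  rw [En_map, MvPolynomial.eval_X, MvPolynomial.eval_X, map_zero] at h'
  have h2 := En_map (c := c) (d := d) (Int.castRingHom ℚ) 1 1 i j
  rw [En_one D, map_one, h'] at h2
  exact hc (by simpa using h2)

/-- The deformed longest element is a monomial times the star permutation. -/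
lemma W0.monomial [Nonempty I] (W : W0 c d RW star) (D : Dat c d r)
    (hconn : ∀ i j : I, Relation.ReflTransGen (fun a b => a ≠ b ∧ c a b ≠ 0) i j) :
    ∃ (k : ℚ) (a b : ℕ), ∀ (v : I → AA) i,
      Tl c d (MvPolynomial.X 0 : AA) (MvPolynomial.X 1) RW v i =
        (MvPolynomial.C k * MvPolynomial.X 0 ^ a * MvPolynomial.X 1 ^ b) * v (star i) := by
  obtain ⟨x, hx⟩ := W.schur D (MvPolynomial.X 0 : AA) (MvPolynomial.X 1) hconn
    (fun i h => by
      have h' := congrArg (MvPolynomial.eval (fun _ => (1:ℚ))) h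
      norm_num at h')
    (fun i j _ hc => En_AA_ne D i j hc)
  obtain ⟨a, b, h⟩ := Tl_surj (c := c) (d := d) (MvPolynomial.X 0 : AA) (MvPolynomial.X 1) RW
  obtain ⟨i0⟩ := ‹Nonempty I›
  obtain ⟨u, hu⟩ := h (ee i0)
  have := congrFun hu i0
  rw [hx] at this
  simp only [Pi.smul_apply, ee_apply, if_true, smul_eq_mul, mul_one] at this
  obtain ⟨k, a', b', e⟩ := dvd_monomial x a b ⟨_, this.symm⟩
  exact ⟨k, a', b', fun v i => by rw [hx, e]⟩

end part3
end S10

namespace S10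

set_option linter.unusedSectionVars false

section part4

variable {I : Type} [Fintype I] [DecidableEq I]
variable {c : I → I → ℤ} {d : I → ℤ} {r : ℤ}

/-- The dual numbers. -/
abbrev SS : Type := DualNumber ℚ

/-- The infinitesimal. -/
def ep : SS := DualNumber.eps

lemma ep2 : ep * ep = 0 := DualNumber.eps_mul_eps

lemma ep_ext (a b : ℚ) (a' b' : ℚ)
    (h : algebraMap ℚ SS a + ep * algebraMap ℚ SS b = algebraMap ℚ SS a' + ep * algebraMap ℚ SS b') :
    a = a' ∧ b = b' := by
  have h1 := congrArg TrivSqZeroExt.fst h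
  have h2 := congrArg TrivSqZeroExt.snd h
  simp only [ep, TrivSqZeroExt.algebraMap_eq_inl, TrivSqZeroExt.fst_add, TrivSqZeroExt.snd_add,
    TrivSqZeroExt.fst_mul, TrivSqZeroExt.snd_mul, DualNumber.fst_eps, DualNumber.snd_eps,
    TrivSqZeroExt.fst_inl, TrivSqZeroExt.snd_inl, smul_zero, zero_add, zero_mul, add_zero,
    zero_smul, MulOpposite.smul_eq_mul_unop, MulOpposite.unop_op, one_mul] at h1 h2
  exact ⟨h1, h2⟩

/-- A vector of dual numbers from two integral vectors, with gauge `g`. -/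
def vec (g x y : I → ℤ) : I → SS := fun k => (x k : SS) + ep * ((y k : SS) - (g k : SS) * (x k : SS))

/-- The derivative vector along a word. -/
def Dv (c : I → I → ℤ) (d : I → ℤ) (κ : I → ℤ) : List I → (I → ℤ) → (I → ℤ) → (I → ℤ)
  | [], _, y => y
  | i :: L, x, y => Dv c d κ L (Th c d 1 1 i x)
      (Th c d 1 1 i y - (κ i * ct c d (1:ℤ) 1 i x) • ee i)

/-- The quadratic sum along a word. -/
def Fs (c : I → I → ℤ) (d : I → ℤ) (κ : I → ℤ) : List I → (I → ℤ) → ℤ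
  | [], _ => 0
  | i :: L, x => κ i * d i * (ct c d (1:ℤ) 1 i x) ^ 2 + Fs c d κ L (Th c d 1 1 i x)

/-- The linear sum along a word. -/
def Gs (c : I → I → ℤ) (d : I → ℤ) (κ : I → ℤ) : List I → (I → ℤ) → ℤ
  | [], _ => 0
  | i :: L, x => κ i * (ct c d (1:ℤ) 1 i x) + Gs c d κ L (Th c d 1 1 i x)

lemma Th_vec (D : Dat c d r) (κ g : I → ℤ) (p t : SS)
    (hE : ∀ i j, En c d p t i j = (c i j : SS) * (1 + ep * ((κ i : SS) + (g j : SS) - (g i : SS))))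
    (i : I) (x y : I → ℤ) :
    Th c d p t i (vec g x y) =
      vec g (Th c d 1 1 i x) (Th c d 1 1 i y - (κ i * ct c d (1:ℤ) 1 i x) • ee i) := by
  have hct : ct c d p t i (vec g x y) = ((ct c d (1:ℤ) 1 i x : ℤ) : SS) +
      ep * (((ct c d (1:ℤ) 1 i y : ℤ) : SS) +
        ((κ i : SS) - (g i : SS)) * ((ct c d (1:ℤ) 1 i x : ℤ) : SS)) := by
    simp only [ct_apply, En_one D, hE, vec]
    push_cast
    rw [Finset.mul_sum, ← Finset.sum_add_distrib, Finset.mul_sum, ← Finset.sum_add_distrib]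
    refine Finset.sum_congr rfl fun j _ => ?_
    linear_combination ((c i j : SS) * ((κ i : SS) + (g j : SS) - (g i : SS)) *
      ((y j : SS) - (g j : SS) * (x j : SS))) * ep2
  funext k
  rw [Th_apply, hct]
  simp only [vec, Th_apply, Pi.sub_apply, Pi.smul_apply, ee_apply, smul_eq_mul]
  by_cases hk : k = i
  · subst hk
    simp only [if_true]
    push_cast
    ring
  · simp only [if_neg hk]
    push_cast
    ring

lemma Tl_vec (D : Dat c d r) (κ g : I → ℤ) (p t : SS)
    (hE : ∀ i j, En c d p t i j = (c i j : SS) * (1 + ep * ((κ i : SS) + (g j : SS) - (g i : SS))))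
    (L : List I) (x y : I → ℤ) :
    Tl c d p t L (vec g x y) = vec g (Al c d L x) (Dv c d κ L x y) := by
  induction L generalizing x y with
  | nil => rfl
  | cons i L ih => rw [Tl_cons, Th_vec D κ g p t hE, ih]; rfl

lemma ct_s (D : Dat c d r) (i : I) (x : I → ℤ) :
    ct c d (1:ℤ) 1 i (Th c d 1 1 i x) = - ct c d (1:ℤ) 1 i x := by
  rw [Th_apply, map_sub, map_smul, ct_ee, En_one D, D.hdiag, smul_eq_mul]; ring

lemma bil_Dv (D : Dat c d r) (κ : I → ℤ) (L : List I) (x y : I → ℤ) :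
    bil c d (Dv c d κ L x y) (Al c d L x) = bil c d y x + Fs c d κ L x := by
  induction L generalizing x y with
  | nil => simp [Dv, Fs, Tl_nil]
  | cons i L ih =>
    rw [Dv, Al_cons, ih, map_sub, map_smul, LinearMap.sub_apply, LinearMap.smul_apply, bil_s D,
      bil_ee, ct_s D, Fs, smul_eq_mul]
    ring

lemma Gs_eq (κ : I → ℤ) (L : List I) (x : I → ℤ) :
    Gs c d κ L x = (∑ k, κ k * x k) - ∑ k, κ k * Al c d L x k := by
  induction L generalizing x with
  | nil => simp [Gs, Tl_nil]
  | cons i L ih =>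
    rw [Gs, ih, Al_cons]
    have : ∑ k, κ k * (Th c d (1:ℤ) 1 i x) k = (∑ k, κ k * x k) - κ i * ct c d (1:ℤ) 1 i x := by
      simp [Th_apply, ee_apply, mul_sub, Finset.sum_sub_distrib]
    rw [this]; ring

/-- The highest root data. -/
structure Hi (c : I → I → ℤ) (d : I → ℤ) (θ : I → ℤ) (M : List I) (i0 : I) : Prop where
  root : θ = Al c d M (ee i0)
  high : ∀ L i k, Al c d L (ee i) k ≤ θ k

variable {θ : I → ℤ} {M : List I} {i0 : I}

lemma Hi.nonneg (H : Hi c d θ M i0) : Pos θ := by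
  intro k
  have := H.high [] i0 k
  rw [Al, Tl_nil, ee_apply] at this
  split_ifs at this <;> omega

lemma Hi.dom (D : Dat c d r) (H : Hi c d θ M i0) (i : I) : 0 ≤ ct c d (1:ℤ) 1 i θ := by
  have := H.high (M ++ [i]) i0 i
  rw [Al_append, ← H.root] at this
  change Th c d 1 1 i θ i ≤ _ at this
  rw [Th_apply] at this
  simp [ee_apply] at this
  exact this

lemma Hi.bil_nonneg (D : Dat c d r) (H : Hi c d θ M i0) {β : I → ℤ} (hβ : Pos β) :
    0 ≤ bil c d β θ := by
  rw [bil_apply]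
  refine Finset.sum_nonneg fun i _ => ?_
  have h1 := D.hdpos i
  have h2 := hβ i
  have h3 := H.dom D i
  positivity

/-- Trichotomy for pairings of positive roots with the highest root. -/
lemma Hi.tri (D : Dat c d r) (H : Hi c d θ M i0) (P : List I) (j : I)
    (hβ : Pos (Al c d P (ee j))) :
    bil c d (Al c d P (ee j)) θ = 0 ∨ bil c d (Al c d P (ee j)) θ = d i0 ∨
      Al c d P (ee j) = θ := by
  set β := Al c d P (ee j) with hβdef
  have hn : bil c d β θ = d i0 * ct c d (1:ℤ) 1 i0 (Al c d M.reverse β) := by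
    rw [bil_symm D, ← bil_ee, ← bil_Al D M.reverse θ, H.root, Al_reverse D]
  set n := ct c d (1:ℤ) 1 i0 (Al c d M.reverse β) with hndef
  have h0 := H.bil_nonneg D hβ
  have hd := D.hdpos i0
  have hn0 : 0 ≤ n := by
    by_contra hneg
    push Not at hneg
    nlinarith
  by_cases e0 : n = 0
  · left; rw [hn, e0, mul_zero]
  by_cases e1 : n = 1
  · right; left; rw [hn, e1, mul_one]
  right; right
  have hrefl : Al c d (j :: (P ++ (M.reverse ++ ([i0] ++ M)))) (ee j) = n • θ - β := by
    rw [Al_cons, s_self D, map_neg, Al_append, Al_append, Al_append, ← hβdef]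
    change -(Al c d M (Th c d 1 1 i0 (Al c d M.reverse β))) = _
    rw [Th_apply, map_sub, map_smul, ← H.root, Al_reverse' D]
    module
  funext k
  have h1 := H.high _ j k |> (congrFun hrefl k ▸ ·)
  have h2 := H.high P j k
  have h3 := H.nonneg k
  simp only [Pi.sub_apply, Pi.smul_apply, smul_eq_mul] at h1
  have h4 : θ k * 1 ≤ θ k * (n - 1) := mul_le_mul_of_nonneg_left (by omega) h3
  rw [← hβdef] at h2
  nlinarith

lemma bil_root (D : Dat c d r) (L : List I) (i : I) :
    bil c d (Al c d L (ee i)) (Al c d L (ee i)) = 2 * d i := by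
  rw [bil_Al D, bil_ee_ee D, D.hdiag]; ring

/-- The highest root is long. -/
lemma Hi.long (D : Dat c d r) (H : Hi c d θ M i0)
    (hconn : ∀ i j : I, Relation.ReflTransGen (fun a b => a ≠ b ∧ c a b ≠ 0) i j)
    (hrmem : ∃ i, d i = r) : d i0 = r := by
  obtain ⟨j, hj⟩ := hrmem
  rcases D.honer i0 with h1 | h1
  swap
  · exact h1
  by_contra hne
  have hr : 2 ≤ r := by
    have := D.hdpos j
    omega
  -- some conjugate of `α_j` is not orthogonal to `θ`
  have hex : ∃ L, bil c d (Al c d L (ee j)) θ ≠ 0 := by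
    by_contra hall
    push Not at hall
    have : ∀ k, ∀ L, bil c d (Al c d L (ee k)) θ = 0 := by
      intro k
      induction hconn j k with
      | refl => exact hall
      | @tail a b _ h ih =>
        intro L
        have h2 := ih (b :: L)
        rw [Al_cons, Th_apply, ct_ee, En_one D, map_sub, map_smul, map_sub, map_smul,
          LinearMap.sub_apply, LinearMap.smul_apply, ih L, zero_sub, smul_eq_mul, neg_eq_zero] at h2
        refine (mul_eq_zero.mp h2).resolve_left ?_
        intro h0
        have := D.hsymm a b
        rw [h0, mul_zero] at this
        rcases mul_eq_zero.mp this with h | h'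
        · exact (D.hdpos a).ne' h
        · exact h.2 h'
    have h2 := this i0 M
    rw [H.root, bil_root D] at h2
    have := D.hdpos i0
    omega
  obtain ⟨L, hL⟩ := hex
  have hex2 : ∃ L, Pos (Al c d L (ee j)) ∧ bil c d (Al c d L (ee j)) θ ≠ 0 := by
    rcases root_sign D L j with h | h
    · exact ⟨L, h, hL⟩
    · refine ⟨j :: L, ?_, ?_⟩
      · rw [Al_cons, s_self D, map_neg]; exact h
      · rw [Al_cons, s_self D, map_neg, map_neg, LinearMap.neg_apply, neg_ne_zero]; exact hL
  obtain ⟨L, hpos, hL⟩ := hex2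
  have hdiv : bil c d (Al c d L (ee j)) θ = r * ct c d (1:ℤ) 1 j (Al c d L.reverse θ) := by
    rw [← hj, ← bil_ee, ← bil_Al D L.reverse, Al_reverse D]
  rcases H.tri D L j hpos with h | h | h
  · exact hL h
  · rw [hdiv, h1] at h
    have := Int.isUnit_iff.mp (IsUnit.of_mul_eq_one _ h)
    omega
  · have h2 := bil_root D L j
    rw [h, H.root, bil_root D] at h2
    omega

/-- A positive root made non-positive by a simple reflection is that simple root. -/
lemma sign_change (D : Dat c d r) (L : List I) (k i : I) (h : Pos (Al c d L (ee k)))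
    (h' : ¬ Pos (Th c d 1 1 i (Al c d L (ee k)))) : Al c d L (ee k) = ee i := by
  have hneg : Pos (-(Th c d 1 1 i (Al c d L (ee k)))) := by
    have e : Th c d 1 1 i (Al c d L (ee k)) = Al c d (L ++ [i]) (ee k) := by
      rw [Al_append]; rfl
    rw [e] at h' ⊢
    exact (root_sign D _ _).resolve_left h'
  set η := Al c d L (ee k) with hη
  have hz : ∀ l, l ≠ i → η l = 0 := by
    intro l hl
    have h1 := h l
    have h2 := hneg l
    rw [Th_apply] at h2
    simp [ee_apply, hl] at h2
    omega
  have e : η = η i • ee i := by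
    funext l
    by_cases hl : l = i
    · subst hl; simp [ee_apply]
    · simp [ee_apply, hl, hz l hl]
  have h1 : ee k = η i • Al c d L.reverse (ee i) := by
    rw [← map_smul, ← e, hη, Al_reverse D]
  have h2 := congrFun h1 k
  simp [ee_apply] at h2
  have h3 : η i = 1 := by
    rcases Int.isUnit_iff.mp (IsUnit.of_mul_eq_one _ h2.symm) with h4 | h4
    · exact h4
    · have := h i; omega
  rw [e, h3, one_smul]

open Classical in
lemma Fs_Gs (D : Dat c d r) (kf : ℤ → ℤ) (L : List I) : ∀ (N : List I) (x : I → ℤ),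
    x = Al c d N (ee i0) →
    (∀ P j Q, L = P ++ j :: Q → d j * ct c d (1:ℤ) 1 j (Al c d P x) = 0 ∨
      d j * ct c d (1:ℤ) 1 j (Al c d P x) = d i0 ∨ Al c d P x = ee j) →
    Fs c d (fun i => kf (d i)) L x = d i0 * Gs c d (fun i => kf (d i)) L x +
      2 * d i0 * kf (d i0) * ((if Pos x then 1 else 0) - (if Pos (Al c d L x) then 1 else 0)) := by
  induction L with
  | nil => intro N x hx _; rw [Al, Tl_nil]; simp only [Fs, Gs]; ring
  | cons i L ih =>
    intro N x hx hgood
    have hx' : Th c d 1 1 i x = Al c d (N ++ [i]) (ee i0) := by rw [Al_append, ← hx]; rfl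
    have ih' := ih (N ++ [i]) (Th c d 1 1 i x) hx' (fun P j Q e => by
      have := hgood (i :: P) j Q (by rw [e]; rfl)
      rwa [Al_cons] at this)
    rw [Fs, Gs, ih', Al_cons]
    have hdi := D.hdpos i
    have hd0 := D.hdpos i0
    by_cases hxi : x = ee i
    · have hdd : d i = d i0 := by
        have h1 := bil_root D N i0
        rw [← hx, hxi, bil_ee_ee D, D.hdiag] at h1
        omega
      have hp : Pos x := by
        intro k; rw [hxi, ee_apply]; split_ifs <;> norm_num
      have hnp : ¬ Pos (Th c d 1 1 i x) := by
        intro h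
        have := h i
        rw [hxi, s_self D] at this
        simp [ee_apply] at this
      have hX : ct c d (1:ℤ) 1 i x = 2 := by rw [hxi, ct_ee, En_one D, D.hdiag]
      rw [if_pos hp, if_neg hnp, hX, hdd]
      ring
    · have hg := hgood [] i L rfl
      rw [Al, Tl_nil] at hg
      set X := ct c d (1:ℤ) 1 i x with hXdef
      have hX0 : 0 ≤ X := by
        by_contra hneg
        push Not at hneg
        have hlt : d i * X < 0 := mul_neg_of_pos_of_neg hdi hneg
        rcases hg with h | h | h
        · omega
        · omega
        · exact hxi h
      have hiff : Pos x ↔ Pos (Th c d 1 1 i x) := by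
        constructor
        · intro hp
          by_contra hnp
          apply hxi
          rw [hx] at hp hnp ⊢
          exact sign_change D N i0 i hp hnp
        · intro hp
          by_contra hnp
          have h1 : Th c d 1 1 i x = ee i := by
            rw [hx'] at hp ⊢
            refine sign_change D (N ++ [i]) i0 i hp ?_
            rw [← hx', ss D]; exact hnp
          have h2 := ct_s D i x
          rw [h1, ct_ee, En_one D, D.hdiag, ← hXdef] at h2
          omega
      have hq : d i * X ^ 2 = d i0 * X := by
        rcases hg with h | h | h
        · rcases mul_eq_zero.mp h with h' | h'
          · omega
          · rw [h']; ring
        · rw [pow_two, ← mul_assoc, h]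
        · exact absurd h hxi
      by_cases hp : Pos x
      · rw [if_pos hp, if_pos (hiff.mp hp)]
        linear_combination (kf (d i)) * hq
      · rw [if_neg hp, if_neg (fun h => hp (hiff.mpr h))]
        linear_combination (kf (d i)) * hq

variable {RW : List I} {star : I → I}

/-- The quadratic sum along the longest word, evaluated at the highest root. -/
lemma Fs_theta (D : Dat c d r) (H : Hi c d θ M i0) (W : W0 c d RW star) (kf : ℤ → ℤ) :
    Fs c d (fun i => kf (d i)) RW θ = 2 * d i0 * (kf (d i0) + ∑ k, θ k * kf (d k)) := by
  classical
  have h := Fs_Gs (i0 := i0) D kf RW M θ H.root (by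
    intro P j Q e
    have hred : Red c d (j :: P.reverse) := by
      have := W.red.reverse D
      rw [e] at this
      simp only [List.reverse_append, List.reverse_cons, List.append_assoc] at this
      exact this.suffix
    have hpos := hred.pos_tail D
    have e1 : bil c d (Al c d P.reverse (ee j)) θ = d j * ct c d (1:ℤ) 1 j (Al c d P θ) := by
      rw [← bil_Al D P, Al_reverse' D, bil_ee]
    rw [← e1]
    rcases H.tri D _ j hpos with h | h | h
    · exact Or.inl h
    · exact Or.inr (Or.inl h)
    · right; right; rw [← h, Al_reverse' D])
  have hnp : ¬ Pos (Al c d RW θ) := by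
    intro h2
    refine not_pos_neg (v := θ) ?_ H.nonneg ?_
    · rw [H.root]; exact Al_ne_zero D _ _
    · intro k
      have := h2 (star k)
      rw [W.Al_eq, W.inv] at this
      simpa using this
  rw [if_pos H.nonneg, if_neg hnp, Gs_eq] at h
  have e : ∑ k, kf (d k) * Al c d RW θ k = - ∑ k, θ k * kf (d k) := by
    rw [← Equiv.sum_comp (Equiv.ofBijective star W.inv.bijective), ← Finset.sum_neg_distrib]
    refine Finset.sum_congr rfl fun k _ => ?_
    rw [Equiv.ofBijective_apply, W.dstar D, W.Al_eq, W.inv]; ring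
  rw [h, e]
  have e2 : ∑ k, kf (d k) * θ k = ∑ k, θ k * kf (d k) :=
    Finset.sum_congr rfl fun k _ => mul_comm _ _
  rw [e2]; ring

end part4
end S10

namespace S10

set_option linter.unusedSectionVars false

section part5

variable {I : Type} [Fintype I] [DecidableEq I]
variable {c : I → I → ℤ} {d : I → ℤ} {r : ℤ}
variable {θ : I → ℤ} {M : List I} {i0 : I} {RW : List I} {star : I → I}

/-- Specialisation of a universal formula for the longest element. -/
lemma Tl_base {R : Type} [CommRing R] [Algebra ℚ R] (x : AA)
    (h : ∀ (v : I → AA) i,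
      Tl c d (MvPolynomial.X 0 : AA) (MvPolynomial.X 1) RW v i = x * v (star i))
    (p t : R) (v : I → R) (i : I) :
    Tl c d p t RW v i = MvPolynomial.aeval ![p, t] x * v (star i) := by
  have hee : ∀ j, Tl c d p t RW (ee j) i = MvPolynomial.aeval ![p, t] x * (ee j : I → R) (star i) := by
    intro j
    have h1 := Tl_map (c := c) (d := d) (MvPolynomial.aeval ![p, t] : AA →ₐ[ℚ] R).toRingHom
      (MvPolynomial.X 0 : AA) (MvPolynomial.X 1) RW (ee j)
    have h2 := congrFun h1 i
    rw [h] at h2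
    simp only [AlgHom.toRingHom_eq_coe, RingHom.coe_coe, MvPolynomial.aeval_X, map_mul] at h2
    have e : (fun k => (MvPolynomial.aeval ![p, t] : AA →ₐ[ℚ] R) ((ee j : I → AA) k)) = ee j := by
      funext k
      simp only [ee_apply]
      split_ifs <;> simp
    have e' := congrFun e (star i)
    rw [e'] at h2
    rw [e] at h2
    exact h2
  conv_lhs => rw [vec_sum v]
  rw [map_sum, Finset.sum_apply]
  simp only [map_smul, Pi.smul_apply, hee, smul_eq_mul]
  conv_rhs => rw [vec_sum v]
  rw [Finset.sum_apply, Finset.mul_sum]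
  refine Finset.sum_congr rfl fun j _ => ?_
  simp only [Pi.smul_apply, smul_eq_mul]
  ring

lemma Hi.ne (D : Dat c d r) (H : Hi c d θ M i0) : ∃ k, θ k ≠ 0 := by
  by_contra h
  push Not at h
  have h0 : θ = 0 := funext h
  have := bil_root D M i0
  rw [← H.root, h0] at this
  have := D.hdpos i0
  simp at *
  omega

lemma exp_step (W : W0 c d RW star) (D : Dat c d r) (H : Hi c d θ M i0) (k : ℚ) (m : ℕ)
    (κ g : I → ℤ) (hg : ∀ i, g (star i) = g i) (p t : SS)
    (hE : ∀ i j, En c d p t i j = (c i j : SS) * (1 + ep * ((κ i : SS) + (g j : SS) - (g i : SS))))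
    (hT : ∀ (v : I → SS) i, Tl c d p t RW v i =
      (algebraMap ℚ SS k * (1 + ep * (m : SS))) * v (star i)) :
    k = -1 ∧ (m : ℤ) * (2 * d i0) = Fs c d κ RW θ := by
  have key : ∀ i, (-(θ (star i)) : ℚ) = k * θ (star i) ∧
      ((Dv c d κ RW θ 0 i : ℤ) : ℚ) + g i * θ (star i) =
        k * m * θ (star i) - k * g i * θ (star i) := by
    intro i
    have h1 := hT (vec g θ 0) i
    rw [Tl_vec D κ g p t hE] at h1
    simp only [vec, W.Al_eq, hg, Pi.zero_apply] at h1
    refine ep_ext _ _ _ _ ?_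
    simp only [map_neg, map_add, map_sub, map_mul, map_intCast, map_natCast]
    push_cast at h1
    linear_combination h1 + (algebraMap ℚ SS k * (m : SS) * (- (g i : SS) * (θ (star i) : SS))) * ep2
  have hk : k = -1 := by
    obtain ⟨j, hj⟩ := H.ne D
    have := (key (star j)).1
    rw [W.inv j] at this
    have hj' : (θ j : ℚ) ≠ 0 := by exact_mod_cast hj
    have h0 : (k + 1) * (θ j : ℚ) = 0 := by linarith
    rcases mul_eq_zero.mp h0 with h | h
    · linarith
    · exact absurd h hj'
  refine ⟨hk, ?_⟩
  have hD : Dv c d κ RW θ 0 = (m : ℤ) • Al c d RW θ := by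
    funext i
    have := (key i).2
    rw [hk] at this
    rw [Pi.smul_apply, W.Al_eq, smul_eq_mul]
    have h2 : ((Dv c d κ RW θ 0 i : ℤ) : ℚ) = ((m : ℤ) * (- θ (star i)) : ℤ) := by
      push_cast; linarith
    exact_mod_cast h2
  have h3 := bil_Dv D κ RW θ 0
  rw [hD, map_smul, LinearMap.smul_apply, bil_Al D, map_zero, LinearMap.zero_apply, zero_add] at h3
  rw [← h3]
  conv_rhs => rw [H.root]
  rw [bil_root D, smul_eq_mul]

lemma ep_pow (n : ℕ) : (1 + ep) ^ n = 1 + ep * (n : SS) := by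
  induction n with
  | zero => simp
  | succ n ih =>
    rw [pow_succ, ih]; push_cast
    linear_combination (n : SS) * ep2

lemma ep_sum (m : ℕ) : (∑ k ∈ Finset.range m, (1 + ep) ^ (2 * k)) =
    (m : SS) * (1 + ep * ((m : SS) - 1)) := by
  induction m with
  | zero => simp
  | succ n ih =>
    rw [Finset.sum_range_succ, ih, ep_pow]; push_cast
    ring

lemma En_t (D : Dat c d r) (i j : I) : En c d (1 : SS) (1 + ep) i j = (c i j : SS) * (1 + ep) := by
  by_cases h : i = j
  · subst h
    rw [En_self, D.hdiag, one_pow]; push_cast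
    linear_combination ep2
  · rw [En_ne _ _ h]
    have h0 := D.hoff i j h
    have e : ((-(c i j)).toNat : SS) = -(c i j : SS) := by
      rw [← Int.cast_natCast, Int.toNat_of_nonneg (by omega)]; push_cast; rfl
    simp [e]
    ring

lemma En_p (D : Dat c d r) (i j : I) :
    En c d (1 + ep : SS) 1 i j = (c i j : SS) * (1 + ep * (d j : SS)) := by
  by_cases h : i = j
  · subst h
    rw [En_self, D.hdiag, ep_pow]
    have e : ((d i).toNat : SS) = (d i : SS) := by
      rw [← Int.cast_natCast, Int.toNat_of_nonneg (D.hdpos i).le]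
    push_cast
    rw [e]
    ring
  · rw [En_ne _ _ h, ep_sum, ep_pow]
    have h0 := D.hoff i j h
    have e : ((-(c i j)).toNat : SS) = -(c i j : SS) := by
      rw [← Int.cast_natCast, Int.toNat_of_nonneg (by omega)]; push_cast; rfl
    have h1 : 0 ≤ d j + 1 + c i j := by
      have := D.hdpos j
      rcases cases2 D h with h2 | h2 | h2 | h2 <;> omega
    have e' : ((d j + 1 + c i j).toNat : SS) = (d j : SS) + 1 + (c i j : SS) := by
      rw [← Int.cast_natCast, Int.toNat_of_nonneg h1]; push_cast; rfl
    rw [e, e']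
    linear_combination ((d j : SS) + 1 + (c i j : SS)) * (c i j : SS) * (-(c i j : SS) - 1) * ep2

/-- The deformed longest element acts by an explicit monomial times the diagram involution. -/
theorem W0.main [Nonempty I] (W : W0 c d RW star) (D : Dat c d r) (H : Hi c d θ M i0)
    (hconn : ∀ i j : I, Relation.ReflTransGen (fun a b => a ≠ b ∧ c a b ≠ 0) i j)
    (hrmem : ∃ i, d i = r) :
    ∃ a b : ℕ, (a : ℤ) = r + ∑ k, θ k * d k ∧ (b : ℤ) = 1 + ∑ k, θ k ∧
      ∀ (v : I → AA) i,
      Tl c d (MvPolynomial.X 0 : AA) (MvPolynomial.X 1) RW v i =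
        -(MvPolynomial.X 0 ^ a * MvPolynomial.X 1 ^ b) * v (star i) := by
  obtain ⟨k, a, b, h⟩ := W.monomial D hconn
  have hd0 := D.hdpos i0
  have h1 := exp_step W D H k b (fun _ => 1) (fun _ => 0) (fun _ => rfl) (1 : SS) (1 + ep)
    (fun i j => by rw [En_t D]; push_cast; ring)
    (fun v i => by
      rw [Tl_base _ h]
      simp only [map_mul, map_pow, MvPolynomial.aeval_X, MvPolynomial.aeval_C]
      simp [ep_pow])
  have h2 := exp_step W D H k a d d (fun i => W.dstar D i) (1 + ep : SS) 1
    (fun i j => by rw [En_p D]; push_cast; ring)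
    (fun v i => by
      rw [Tl_base _ h]
      simp only [map_mul, map_pow, MvPolynomial.aeval_X, MvPolynomial.aeval_C]
      simp [ep_pow])
  have f1 := Fs_theta D H W (fun _ => 1)
  have f2 := Fs_theta D H W (fun x => x)
  have hl := H.long D hconn hrmem
  refine ⟨a, b, ?_, ?_, ?_⟩
  · have := h2.2.trans f2
    rw [hl] at this
    have hr : (2 * r) ≠ 0 := by omega
    apply mul_right_cancel₀ hr
    rw [this]; ring
  · have := h1.2.trans f1
    have hr : (2 * d i0) ≠ 0 := by omega
    apply mul_right_cancel₀ hr
    rw [this]; simp only [mul_one]; ring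
  · intro v i
    rw [h, h1.1]
    simp only [map_neg, map_one]
    ring

end part5

end S10

namespace S10

set_option linter.unusedSectionVars false

section part6

variable {I : Type} [Fintype I] [DecidableEq I]
variable {c : I → I → ℤ} {d : I → ℤ} {r : ℤ}

section gen
variable {R : Type} [CommRing R]

/-- The product of deformed reflections along a word. -/
def Tw (c : I → I → ℤ) (d : I → ℤ) (p t : R) : List I → ((I → R) →ₗ[R] (I → R))
  | [] => LinearMap.id
  | i :: L => (Th c d p t i) ∘ₗ (Tw c d p t L)

/-- The partial sums of deformed roots. -/
def Ph (c : I → I → ℤ) (d : I → ℤ) (p t : R) : List I → I → (I → R)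
  | [], _ => 0
  | i :: L, j => (if i = j then ee j else 0) + Th c d p t i (Ph c d p t L j)

lemma Tw_eq (p t : R) (L : List I) (v : I → R) : Tw c d p t L v = Tl c d p t L.reverse v := by
  induction L with
  | nil => rfl
  | cons i L ih =>
    rw [List.reverse_cons, Tl_append, ← ih]; rfl

lemma telescope (p t : R) (L : List I) (v : I → R) :
    v - Tw c d p t L v = ∑ j, ct c d p t j v • Ph c d p t L j := by
  induction L with
  | nil => simp [Tw, Ph]
  | cons i L ih =>
    have e1 : Tw c d p t (i :: L) v = Th c d p t i (Tw c d p t L v) := rfl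
    have e2 : v - Th c d p t i (Tw c d p t L v) =
        ct c d p t i v • ee i + Th c d p t i (v - Tw c d p t L v) := by
      rw [map_sub, Th_apply _ _ _ _ i v]; abel
    rw [e1, e2, ih, map_sum]
    simp only [Ph, smul_add, Finset.sum_add_distrib, map_smul]
    congr 1
    simp

lemma Ph_map {S : Type} [CommRing S] (f : R →+* S) (p t : R) (L : List I) (j : I) :
    (fun k => f (Ph c d p t L j k)) = Ph c d (f p) (f t) L j := by
  induction L with
  | nil => funext k; simp [Ph]
  | cons i L ih =>
    have h := Tl_map (c := c) (d := d) f p t [i] (Ph c d p t L j)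
    have h1 : ∀ v : I → S, Tl c d (f p) (f t) [i] v = Th c d (f p) (f t) i v := fun _ => rfl
    have h2 : ∀ v : I → R, Tl c d p t [i] v = Th c d p t i v := fun _ => rfl
    rw [h1, h2, ih] at h
    simp only [Ph, h]
    funext k
    simp only [Pi.add_apply, map_add]
    congr 1
    split_ifs
    · simp only [ee_apply]; split_ifs <;> simp
    · simp

lemma Ph_sum (p t : R) (L : List I) (j : I) :
    Ph c d p t L j = ∑ k : Fin L.length, if L.get k = j then Tw c d p t (L.take k.1) (ee j) else 0 := by
  induction L with
  | nil => simp [Ph]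
  | cons i L ih =>
    have e : (∑ k : Fin (i :: L).length, if (i :: L).get k = j then
        Tw c d p t ((i :: L).take k.1) (ee j) else 0) =
        ∑ k : Fin (L.length + 1), if (i :: L).get k = j then
        Tw c d p t ((i :: L).take k.1) (ee j) else 0 := rfl
    rw [e, Fin.sum_univ_succ]
    simp only [Ph, ih, map_sum]
    congr 1
    refine Finset.sum_congr rfl fun k _ => ?_
    have e2 : (i :: L).get k.succ = L.get k := rfl
    rw [e2]
    split_ifs
    · rfl
    · rw [map_zero]

end gen

section fld
variable {F : Type} [Field F]

/-- The deformed Cartan matrix over a field. -/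
def CF (c : I → I → ℤ) (d : I → ℤ) (q t : F) (i j : I) : F :=
  if i = j then q ^ (d i) * t⁻¹ + q ^ (-(d i)) * t else
    (q ^ (c i j) - q ^ (-(c i j))) / (q - q⁻¹)

lemma CF_inv (q t : F) (i j : I) : CF c d q⁻¹ t⁻¹ i j = CF c d q t i j := by
  unfold CF
  split_ifs
  · rw [inv_inv, inv_zpow', inv_zpow', neg_neg]; ring
  · rw [inv_inv, inv_zpow', inv_zpow', neg_neg, ← neg_sub (q ^ (c i j)), ← neg_sub q, neg_div_neg_eq]

lemma geom (q : F) (hq : q ≠ 0) (hq1 : q - q⁻¹ ≠ 0) (m : ℕ) :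
    (q ^ (m : ℤ) - q ^ (-(m : ℤ))) / (q - q⁻¹) =
      q ^ ((m : ℤ) - 1) * ∑ k ∈ Finset.range m, q⁻¹ ^ (2 * k) := by
  rw [div_eq_iff hq1]
  induction m with
  | zero => simp
  | succ m ih =>
    rw [Finset.sum_range_succ]
    have e0 : q ^ (m : ℤ) = q ^ ((m : ℤ) - 1) * q := by rw [← zpow_add_one₀ hq]; simp
    have e1 : q ^ (((m + 1 : ℕ) : ℤ)) = q ^ (m : ℤ) * q := by push_cast; rw [zpow_add_one₀ hq]
    have e2 : q ^ (-((m + 1 : ℕ) : ℤ)) = q ^ (-(m : ℤ)) * q⁻¹ := by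
      push_cast; rw [neg_add, ← sub_eq_add_neg, zpow_sub_one₀ hq]
    have e3 : q ^ (((m + 1 : ℕ) : ℤ) - 1) = q ^ (m : ℤ) := by push_cast; congr 1; ring
    have e4 : q ^ (m : ℤ) * q⁻¹ ^ (2 * m) = q ^ (-(m : ℤ)) := by
      rw [inv_pow, ← zpow_natCast q (2 * m), ← zpow_neg, ← zpow_add₀ hq]
      congr 1; push_cast; ring
    rw [e1, e2, e3, mul_add, e4, add_mul]
    have : q ^ (m : ℤ) * (∑ k ∈ Finset.range m, q⁻¹ ^ (2 * k)) * (q - q⁻¹) =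
        q * (q ^ (m : ℤ) - q ^ (-(m : ℤ))) := by rw [ih]; rw [e0]; ring
    rw [this]
    ring

lemma En_CF (D : Dat c d r) (q t : F) (hq : q ≠ 0) (ht : t ≠ 0) (hq1 : q - q⁻¹ ≠ 0) (i j : I) :
    En c d q⁻¹ t i j = t * CF c d q t i j * q ^ (-(d j)) := by
  by_cases h : i = j
  · subst h
    rw [En_self]
    simp only [CF, if_true]
    have h1 : q⁻¹ ^ (2 * (d i).toNat) = q ^ (-(d i)) * q ^ (-(d i)) := by
      rw [← zpow_add₀ hq, inv_pow, ← zpow_natCast, ← zpow_neg]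
      congr 1
      push_cast
      rw [Int.toNat_of_nonneg (D.hdpos i).le]; ring
    have h2 : q ^ (d i) * q ^ (-(d i)) = 1 := by rw [← zpow_add₀ hq]; simp
    rw [h1]
    have h3 : t * t⁻¹ = 1 := mul_inv_cancel₀ ht
    linear_combination (-1 : F) * h2 * (t * t⁻¹) - h3
  · rw [En_ne _ _ h]
    simp only [CF, if_neg h]
    have h0 := D.hoff i j h
    obtain ⟨m, hm⟩ : ∃ m : ℕ, c i j = -(m : ℤ) := ⟨(-(c i j)).toNat, by omega⟩
    have h1 : 0 ≤ d j + 1 + c i j := by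
      have := D.hdpos j
      rcases cases2 D h with h2 | h2 | h2 | h2 <;> omega
    rw [hm] at h1 ⊢
    have g := geom q hq hq1 m
    rw [neg_neg, ← neg_sub (q ^ (m : ℤ)), neg_div, g, Int.toNat_natCast]
    have e : q⁻¹ ^ (d j + 1 + -(m : ℤ)).toNat = q ^ ((m : ℤ) - 1) * q ^ (-(d j)) := by
      rw [inv_pow, ← zpow_natCast, ← zpow_neg, ← zpow_add₀ hq]
      congr 1
      rw [Int.toNat_of_nonneg h1]; ring
    rw [e]
    ring

variable {RW : List I} {star : I → I}

/-- The key identity expressing partial sums by the inverse deformed Cartan matrix. -/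
lemma Ph_inv (D : Dat c d r) (q t : F) (hq : q ≠ 0) (ht : t ≠ 0) (hq1 : q - q⁻¹ ≠ 0)
    (ww : List I) (x : F)
    (hT : ∀ (v : I → F) i, Tl c d q⁻¹ t ww.reverse v i = -x * v (star i))
    (Ci : Matrix I I F) (hCi : (Matrix.of (CF c d q t)) * Ci = 1)
    (hds : ∀ i, d (star i) = d i) (i j : I) :
    q ^ (-(d i)) * t * Ph c d q⁻¹ t ww j i = Ci i j + x * Ci (star i) j := by
  have h := telescope (c := c) (d := d) q⁻¹ t ww (fun k => Ci k j * q ^ (d k) * t⁻¹)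
  have hct : ∀ k, ct c d q⁻¹ t k (fun k => Ci k j * q ^ (d k) * t⁻¹) = if k = j then 1 else 0 := by
    intro k
    rw [ct_apply]
    have h1 := congrFun (congrFun hCi k) j
    rw [Matrix.mul_apply, Matrix.one_apply] at h1
    rw [← h1]
    refine Finset.sum_congr rfl fun l _ => ?_
    rw [En_CF D q t hq ht hq1, Matrix.of_apply]
    have h2 : q ^ (d l) * q ^ (-(d l)) = 1 := by rw [← zpow_add₀ hq]; simp
    have h3 : t * t⁻¹ = 1 := mul_inv_cancel₀ ht
    linear_combination CF c d q t k l * Ci l j * (h2 * (t * t⁻¹) + h3)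
  simp only [hct, ite_smul, one_smul, zero_smul, Finset.sum_ite_eq', Finset.mem_univ, if_true] at h
  rw [← h, Pi.sub_apply, Tw_eq, hT, hds]
  have h2 : q ^ (d i) * q ^ (-(d i)) = 1 := by rw [← zpow_add₀ hq]; simp
  have h3 : t * t⁻¹ = 1 := mul_inv_cancel₀ ht
  linear_combination (Ci i j + x * Ci (star i) j) * (h2 * (t * t⁻¹) + h3)

end fld

end part6

end S10

namespace S10

set_option linter.unusedSectionVars false

section part7

variable {I : Type} [Fintype I] [DecidableEq I]
variable {c : I → I → ℤ} {d : I → ℤ} {r : ℤ}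

/-- Monomials in the iterated Laurent series field. -/
def mono (x y : ℤ) : LL := HahnSeries.single y (HahnSeries.single x (1 : ℚ))

lemma mono_mul (x y x' y' : ℤ) : mono x y * mono x' y' = mono (x + x') (y + y') := by
  simp [mono, HahnSeries.single_mul_single]

lemma mono_zero : mono 0 0 = 1 := rfl

lemma mono_pow (x y : ℤ) (n : ℕ) : mono x y ^ n = mono (n * x) (n * y) := by
  induction n with
  | zero => simp [mono_zero]
  | succ n ih => rw [pow_succ, ih, mono_mul]; push_cast; congr 1 <;> ring

lemma mono_inv (x y : ℤ) : (mono x y)⁻¹ = mono (-x) (-y) := by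
  refine inv_eq_of_mul_eq_one_right ?_
  rw [mono_mul, add_neg_cancel, add_neg_cancel, mono_zero]

lemma qL_mono : qL = mono 1 0 := rfl

lemma tL_mono : tL = mono 0 (-1) := rfl

lemma coeff_mono_mul (x y : ℤ) (z : LL) (u v : ℤ) :
    ((mono x y * z).coeff v).coeff u = (z.coeff (v - y)).coeff (u - x) := by
  rw [mono, HahnSeries.coeff_single_mul, HahnSeries.coeff_single_mul, one_mul]

lemma coeff_rat_mono (k : ℚ) (x y u v : ℤ) :
    (((algebraMap ℚ LL k) * mono x y).coeff v).coeff u = if u = x ∧ v = y then k else 0 := by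
  rw [mul_comm, coeff_mono_mul]
  have e : algebraMap ℚ LL k = HahnSeries.single 0 (HahnSeries.single 0 k) := by
    exact RingHom.congr_fun (RingHom.ext_rat (algebraMap ℚ LL)
      ((HahnSeries.C : FF →+* LL).comp (HahnSeries.C : ℚ →+* FF))) k
  rw [e, HahnSeries.coeff_single]
  split_ifs with h1 h2 h2
  · rw [HahnSeries.coeff_single, if_pos (by omega)]
  · rw [HahnSeries.coeff_single, if_neg (by omega)]
  · omega
  · rfl

lemma aeval_sum {R : Type} [CommRing R] [Algebra ℚ R] (x y : R) (G : AA) :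
    MvPolynomial.aeval ![x, y] G =
      ∑ n ∈ G.support, algebraMap ℚ R (G.coeff n) * (x ^ (n 0) * y ^ (n 1)) := by
  rw [MvPolynomial.aeval_def, MvPolynomial.eval₂_eq']
  simp [Fin.prod_univ_two]

lemma fin_ext {m n : Fin 2 →₀ ℕ} (h0 : m 0 = n 0) (h1 : m 1 = n 1) : m = n := by
  ext i; fin_cases i
  · exact h0
  · exact h1

lemma coeff_G (G : AA) (m : Fin 2 →₀ ℕ) :
    ((MvPolynomial.aeval ![mono 1 0, mono 0 1] G : LL).coeff (m 1)).coeff (m 0) = G.coeff m := by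
  rw [aeval_sum]
  simp only [mono_pow, mono_mul, HahnSeries.coeff_sum, coeff_rat_mono]
  rw [Finset.sum_eq_single m]
  · rw [if_pos]; constructor <;> ring
  · intro n _ hn
    rw [if_neg]
    rintro ⟨h1, h2⟩
    refine hn (fin_ext ?_ ?_) <;> omega
  · intro hm
    rw [MvPolynomial.notMem_support_iff.mp hm]; simp

lemma coeff_G_ne (G G' : AA) (a b : ℕ)
    (h : (MvPolynomial.aeval ![mono 1 0, mono 0 1] G : LL) =
      mono a b * MvPolynomial.aeval ![mono (-1) 0, mono 0 (-1)] G') (m : Fin 2 →₀ ℕ)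
    (hm : G.coeff m ≠ 0) : m 0 ≤ a ∧ m 1 ≤ b := by
  rw [← coeff_G, h, coeff_mono_mul, aeval_sum] at hm
  simp only [mono_pow, mono_mul, HahnSeries.coeff_sum, coeff_rat_mono] at hm
  obtain ⟨n, _, hn⟩ := Finset.exists_ne_zero_of_sum_ne_zero hm
  split_ifs at hn with h1
  · omega
  · exact absurd rfl hn

/-- The exponent vector. -/
def fs (u v : ℕ) : Fin 2 →₀ ℕ := Finsupp.single 0 u + Finsupp.single 1 v

lemma fs_zero (u v : ℕ) : fs u v 0 = u := by simp [fs]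
lemma fs_one (u v : ℕ) : fs u v 1 = v := by simp [fs]

lemma aeval_box {R : Type} [CommRing R] [Algebra ℚ R] (x y : R) (G : AA) (a b : ℕ)
    (h : ∀ m, G.coeff m ≠ 0 → m 0 ≤ a ∧ m 1 ≤ b) :
    MvPolynomial.aeval ![x, y] G = ∑ u ∈ Finset.range (a + 1), ∑ v ∈ Finset.range (b + 1),
      algebraMap ℚ R (G.coeff (fs u v)) * (x ^ u * y ^ v) := by
  rw [aeval_sum, ← Finset.sum_product']
  refine Finset.sum_of_injOn (fun n : Fin 2 →₀ ℕ => (n 0, n 1)) ?_ ?_ ?_ ?_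
  · intro m _ n _ e
    simp only [Prod.mk.injEq] at e
    exact fin_ext e.1 e.2
  · intro m hm
    have := h m (MvPolynomial.mem_support_iff.mp hm)
    simp only [Finset.coe_product, Set.mem_prod, Finset.mem_coe, Finset.mem_range]
    omega
  · rintro ⟨u, v⟩ _ hn
    have h0 : G.coeff (fs u v) = 0 := by
      by_contra hc
      exact hn ⟨fs u v, MvPolynomial.mem_support_iff.mpr hc, by simp only [fs_zero, fs_one]⟩
    simp only [h0, map_zero, zero_mul]
  · intro m _
    have e : fs (m 0) (m 1) = m := fin_ext (fs_zero _ _) (fs_one _ _)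
    simp only [e]

lemma sum_Icc_int {R : Type} [AddCommMonoid R] (a : ℕ) (f : ℤ → R) :
    ∑ u ∈ Finset.Icc (0 : ℤ) a, f u = ∑ u ∈ Finset.range (a + 1), f u := by
  symm
  refine Finset.sum_bij (fun u _ => (u : ℤ)) ?_ ?_ ?_ ?_
  · intro u hu; simp at hu ⊢; omega
  · intro u _ v _ h; exact_mod_cast h
  · intro u hu
    rw [Finset.mem_Icc] at hu
    exact ⟨u.toNat, by rw [Finset.mem_range]; omega, by omega⟩
  · intro u _; rfl

/-- Series without terms of outer exponent at most zero. -/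
def Small (z : LL) : Prop := ∀ n : ℤ, n ≤ 0 → z.coeff n = 0

lemma qv_ne : qv ≠ 0 := by
  unfold qv
  rw [Ne, IsFractionRing.to_map_eq_zero_iff]
  exact MvPolynomial.X_ne_zero 0

lemma tv_ne : tv ≠ 0 := by
  unfold tv
  rw [Ne, IsFractionRing.to_map_eq_zero_iff]
  exact MvPolynomial.X_ne_zero 1

lemma phi_aeval (φ : KK →+* LL) (x y : KK) (G : AA) :
    φ (MvPolynomial.aeval ![x, y] G) = MvPolynomial.aeval ![φ x, φ y] G := by
  rw [aeval_sum, aeval_sum, map_sum]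
  refine Finset.sum_congr rfl fun n _ => ?_
  rw [map_mul, map_mul, map_pow, map_pow]
  congr 1
  exact RingHom.congr_fun (RingHom.ext_rat (φ.comp (algebraMap ℚ KK)) (algebraMap ℚ LL)) _

/-- The abstract truncation argument. -/
lemma final (φ : KK →+* LL) (hφq : φ qv = qL) (hφt : φ tv = tL) (G G' : AA) (x y : KK) (a b : ℕ)
    (h1 : MvPolynomial.aeval ![qv⁻¹, tv] G' = y + (qv⁻¹ ^ a * tv ^ b) * x)
    (h2 : MvPolynomial.aeval ![qv, tv⁻¹] G = x + (qv ^ a * tv⁻¹ ^ b) * y)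
    (hy : Small (φ y)) :
    MvPolynomial.aeval ![qv⁻¹, tv] G = ∑ u ∈ Finset.Icc (0 : ℤ) a, ∑ v ∈ Finset.Icc (0 : ℤ) b,
      ((dcoeff (φ x) u (-v) : ℚ) : KK) * qv ^ (-u) * tv ^ v := by
  have hti : φ tv⁻¹ = mono 0 1 := by rw [map_inv₀, hφt, tL_mono, mono_inv]; simp
  have hqi : φ qv⁻¹ = mono (-1) 0 := by rw [map_inv₀, hφq, qL_mono, mono_inv]; simp
  have hab : φ (qv ^ a * tv⁻¹ ^ b) = mono a b := by
    rw [map_mul, map_pow, map_pow, hti, hφq, qL_mono, mono_pow, mono_pow, mono_mul]; simp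
  have hG : ∀ m, G.coeff m ≠ 0 → m 0 ≤ a ∧ m 1 ≤ b := by
    apply coeff_G_ne G G'
    have e : MvPolynomial.aeval ![qv, tv⁻¹] G =
        (qv ^ a * tv⁻¹ ^ b) * MvPolynomial.aeval ![qv⁻¹, tv] G' := by
      rw [h1, h2]
      have e1 : qv ^ a * qv⁻¹ ^ a = 1 := by rw [← mul_pow, mul_inv_cancel₀ qv_ne, one_pow]
      have e2 : tv ^ b * tv⁻¹ ^ b = 1 := by rw [← mul_pow, mul_inv_cancel₀ tv_ne, one_pow]
      linear_combination (-x) * (e1 * (tv ^ b * tv⁻¹ ^ b) + e2)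
    have e' := congrArg φ e
    rw [map_mul, hab, phi_aeval, phi_aeval, hti, hqi, hφq, hφt, qL_mono, tL_mono] at e'
    exact e'
  rw [aeval_box _ _ G a b hG, sum_Icc_int]
  refine Finset.sum_congr rfl fun u hu => ?_
  rw [sum_Icc_int]
  refine Finset.sum_congr rfl fun v hv => ?_
  have hc : dcoeff (φ x) u (-v) = G.coeff (fs u v) := by
    have h3 := congrArg φ h2
    rw [map_add, map_mul, hab, phi_aeval, hti, hφq, qL_mono] at h3
    have h4 := coeff_G G (fs u v)
    rw [h3, fs_zero, fs_one, HahnSeries.coeff_add, HahnSeries.coeff_add, coeff_mono_mul,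
      hy _ (by rw [Finset.mem_range] at hv; omega)] at h4
    rw [← h4, dcoeff, neg_neg]
    simp
  rw [hc, zpow_neg, zpow_natCast, zpow_natCast, inv_pow, eq_ratCast, mul_assoc]

/-- The inverse of the deformed Cartan matrix, expanded. -/
lemma inv_small (D : Dat c d r) (φ : KK →+* LL) (hφq : φ qv = qL) (hφt : φ tv = tL)
    (hq1 : qv - qv⁻¹ ≠ 0) :
    (Matrix.of (CF c d qv tv)) * (Matrix.of (CF c d qv tv))⁻¹ = 1 ∧
      ∀ i j, Small (φ ((Matrix.of (CF c d qv tv))⁻¹ i j)) := by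
  have hti : φ tv⁻¹ = mono 0 1 := by rw [map_inv₀, hφt, tL_mono, mono_inv]; simp
  let qs : PowerSeries FF := PowerSeries.C (HahnSeries.single 1 (1 : ℚ))
  let E : Matrix I I (PowerSeries FF) := Matrix.of (En c d qs PowerSeries.X)
  let ι : PowerSeries FF →+* LL := HahnSeries.ofPowerSeries ℤ FF
  have hιq : ι qs = mono 1 0 := by
    simp only [ι, qs, HahnSeries.ofPowerSeries_C]; rfl
  have hιt : ι PowerSeries.X = mono 0 1 := by
    simp only [ι, HahnSeries.ofPowerSeries_X]; rfl
  have hE : IsUnit E.det := by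
    rw [PowerSeries.isUnit_iff_constantCoeff, RingHom.map_det]
    have e : (PowerSeries.constantCoeff (R := FF)).mapMatrix E = 1 := by
      ext i j : 1
      rw [RingHom.mapMatrix_apply, Matrix.map_apply]
      simp only [E, Matrix.of_apply]
      rw [En_map, PowerSeries.constantCoeff_X]
      simp only [En, Matrix.one_apply]
      split_ifs <;> simp
    rw [e, Matrix.det_one]
    exact isUnit_one
  let Y : Matrix I I (PowerSeries FF) := E⁻¹
  have hEY : E * Y = 1 := Matrix.mul_nonsing_inv _ hE
  let C : Matrix I I KK := Matrix.of (CF c d qv tv)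
  -- the explicit inverse over the Laurent series field
  let Z : Matrix I I LL := Matrix.of fun i j =>
    ι (qs ^ (d i).toNat * PowerSeries.X * Y i j)
  have hCE : ∀ i j, φ (C i j) * (mono 1 0 ^ (d j).toNat * mono 0 1) = ι (E i j) := by
    intro i j
    have h1 := En_CF D qv⁻¹ tv⁻¹ (inv_ne_zero qv_ne) (inv_ne_zero tv_ne)
      (by rw [inv_inv, ← neg_sub, neg_ne_zero]; exact hq1) i j
    rw [CF_inv, inv_inv, inv_zpow', neg_neg] at h1
    have h2 := congrArg φ h1
    rw [En_map, map_mul, map_mul, hti, hφq, qL_mono] at h2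
    simp only [E, Matrix.of_apply]
    rw [En_map, hιq, hιt, h2]
    have e : φ (qv ^ (d j)) = mono 1 0 ^ (d j).toNat := by
      have : d j = ((d j).toNat : ℤ) := (Int.toNat_of_nonneg (D.hdpos j).le).symm
      rw [this, zpow_natCast, map_pow, hφq, qL_mono, Int.toNat_natCast]
    rw [e]
    simp only [C, Matrix.of_apply]
    ring
  have hCZ : φ.mapMatrix C * Z = 1 := by
    ext i j : 1
    have h1 := congrArg ι (congrFun (congrFun hEY i) j)
    rw [Matrix.mul_apply] at h1 ⊢
    rw [map_sum] at h1
    have e : ι ((1 : Matrix I I (PowerSeries FF)) i j) = (1 : Matrix I I LL) i j := by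
      simp only [Matrix.one_apply]; split_ifs <;> simp
    rw [e] at h1
    rw [← h1]
    refine Finset.sum_congr rfl fun k _ => ?_
    rw [map_mul, ← hCE, RingHom.mapMatrix_apply, Matrix.map_apply]
    simp only [Z, Matrix.of_apply, map_mul, map_pow, hιq, hιt]
    ring
  have hdet : IsUnit C.det := by
    rw [isUnit_iff_ne_zero]
    intro h0
    have h1 := congrArg Matrix.det hCZ
    rw [Matrix.det_mul, Matrix.det_one, ← RingHom.map_det, h0, map_zero, zero_mul] at h1
    exact zero_ne_one h1
  have hinv : C * C⁻¹ = 1 := Matrix.mul_nonsing_inv _ hdet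
  refine ⟨hinv, fun i j n hn => ?_⟩
  have hZ : φ.mapMatrix C⁻¹ = Z := by
    have h1 : φ.mapMatrix C * φ.mapMatrix C⁻¹ = 1 := by rw [← map_mul, hinv, map_one]
    have h2 : Z * φ.mapMatrix C = 1 := mul_eq_one_comm.mp hCZ
    calc φ.mapMatrix C⁻¹ = (Z * φ.mapMatrix C) * φ.mapMatrix C⁻¹ := by rw [h2, one_mul]
      _ = Z := by rw [mul_assoc, h1, mul_one]
  have h3 := congrFun (congrFun hZ i) j
  rw [RingHom.mapMatrix_apply, Matrix.map_apply] at h3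
  change (φ (C⁻¹ i j)).coeff n = 0
  rw [h3]
  simp only [Z, Matrix.of_apply]
  have e : qs ^ (d i).toNat * PowerSeries.X * Y i j =
      PowerSeries.X * (qs ^ (d i).toNat * Y i j) := by ring
  rw [e, map_mul, hιt, mono, HahnSeries.coeff_single_mul]
  have e2 : (ι (qs ^ (d i).toNat * Y i j)).coeff (n - 1) = 0 := by
    rw [show ι (qs ^ (d i).toNat * Y i j) = HahnSeries.ofPowerSeries ℤ FF _ from rfl,
      HahnSeries.ofPowerSeries_apply]
    apply HahnSeries.embDomain_of_notMem_range
    rintro ⟨k, hk⟩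
    have : (k : ℤ) = n - 1 := hk
    omega
  rw [e2, mul_zero]

end part7

end S10

namespace S10

set_option linter.unusedSectionVars false

section part8

variable {I : Type} [Fintype I] [DecidableEq I]
variable {c : I → I → ℤ} {d : I → ℤ} {r : ℤ}

lemma qv_pow_sub (n : ℤ) (hn : 0 < n) : qv ^ n - qv ^ (-n) ≠ 0 := by
  intro h
  obtain ⟨m, rfl⟩ : ∃ m : ℕ, n = m := ⟨n.toNat, by omega⟩
  have h1 : qv ^ (2 * m) = 1 := by
    have e : qv ^ (m : ℤ) * qv ^ (-(m : ℤ)) = 1 := by rw [← zpow_add₀ qv_ne]; simp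
    rw [sub_eq_zero.mp h, zpow_neg, zpow_natCast] at e
    have hm : qv ^ m ≠ 0 := pow_ne_zero _ qv_ne
    field_simp at e
    rw [mul_comm, pow_mul]
    exact e.symm
  have h2 : (MvPolynomial.X 0 : AA) ^ (2 * m) = 1 := by
    apply IsFractionRing.injective AA KK
    rw [map_pow, map_one]; exact h1
  have h3 := congrArg (MvPolynomial.eval (fun _ => (0:ℚ))) h2
  rw [map_pow, MvPolynomial.eval_X, map_one, zero_pow (by omega)] at h3
  exact zero_ne_one h3

lemma qv_sub : qv - qv⁻¹ ≠ 0 := by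
  have := qv_pow_sub 1 one_pos
  rwa [zpow_one, zpow_neg_one] at this

lemma qint_ne (n : ℤ) (hn : 0 < n) : qint n ≠ 0 := div_ne_zero (qv_pow_sub n hn) qv_sub

lemma Cqt_eq : Cqt c d = CF c d qv tv := rfl

lemma Bform_alpha (i : I) (v : I → KK) :
    Bform c d (alphaK i) v = ∑ j, v j * (qint (d i) * Cqt c d i j) := by
  unfold Bform
  rw [Finset.sum_eq_single i]
  · simp [alphaK]
  · intro k _ hk
    simp [alphaK, hk]
  · intro h; exact absurd (Finset.mem_univ i) h

lemma Bform_coord (m : I → KK) (i : I)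
    (hm : ∀ j, Bform c d m (alphaK j) = if i = j then 1 else 0) (v : I → KK) :
    Bform c d m v = v i := by
  have e : Bform c d m v = ∑ j, v j * Bform c d m (alphaK j) := by
    unfold Bform
    rw [Finset.sum_comm]
    refine Finset.sum_congr rfl fun j _ => ?_
    rw [Finset.mul_sum]
    refine Finset.sum_congr rfl fun k _ => ?_
    rw [Finset.sum_eq_single j]
    · simp [alphaK]; ring
    · intro l _ hl
      simp [alphaK, hl]
    · intro h; exact absurd (Finset.mem_univ j) h
  rw [e]
  simp [hm]

lemma Trefl_conj (D : Dat c d r) (a : I) (s : KK) (w : I → KK) :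
    Trefl c d a (fun k => s * qv ^ (-(d k)) * w k) =
      fun k => s * qv ^ (-(d k)) * Th c d qv⁻¹ tv a w k := by
  funext k
  rw [Th_apply, ct_apply]
  simp only [Trefl, Bform_alpha, Pi.sub_apply, Pi.smul_apply, smul_eq_mul, ee_apply]
  by_cases hk : k = a
  · subst hk
    simp only [alphaK, Pi.single_eq_same, if_true, mul_one]
    rw [mul_sub, Finset.mul_sum, Finset.mul_sum]
    congr 1
    refine Finset.sum_congr rfl fun j _ => ?_
    rw [En_CF D qv tv qv_ne tv_ne qv_sub, Cqt_eq]
    have := qint_ne (d k) (D.hdpos k)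
    field_simp
  · simp [alphaK, hk]

lemma foldr_conj (D : Dat c d r) (j : I) (L : List I) :
    L.foldr (fun a acc => Trefl c d a acc) (alphaK j) =
      fun k => qv ^ (d j) * qv ^ (-(d k)) * Tw c d qv⁻¹ tv L (ee j) k := by
  induction L with
  | nil =>
    funext k
    simp only [List.foldr_nil, Tw, LinearMap.id_apply, alphaK, ee]
    by_cases hk : k = j
    · subst hk
      rw [← zpow_add₀ qv_ne]; simp
    · simp [hk]
  | cons a L ih =>
    rw [List.foldr_cons, ih, Trefl_conj D]; rfl

lemma Pij_eq (D : Dat c d r) (ww : List I) (mu : I → I → KK)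
    (hmu : ∀ i j, Bform c d (mu i) (alphaK j) = if i = j then 1 else 0) (i j : I) :
    Pij c d ww mu i j = qv ^ (d j) * qv ^ (-(d i)) * Ph c d qv⁻¹ tv ww j i := by
  unfold Pij
  rw [Ph_sum, Finset.sum_apply, Finset.mul_sum]
  refine Finset.sum_congr rfl fun k _ => ?_
  split_ifs
  · rw [Bform_coord (mu i) i (hmu i), foldr_conj D]
  · simp

/-- The universal polynomial. -/
def GG (c : I → I → ℤ) (d : I → ℤ) (ww : List I) (i j : I) : AA :=
  MvPolynomial.X 0 ^ (d i).toNat * MvPolynomial.X 1 *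
    Ph c d (MvPolynomial.X 0 : AA) (MvPolynomial.X 1) ww j i

lemma GG_aeval (D : Dat c d r) (p t : KK) (ww : List I) (i j : I) :
    MvPolynomial.aeval ![p, t] (GG c d ww i j) = p ^ (d i) * t * Ph c d p t ww j i := by
  have h := congrFun (Ph_map (c := c) (d := d) (MvPolynomial.aeval ![p, t] : AA →ₐ[ℚ] KK).toRingHom
      (MvPolynomial.X 0 : AA) (MvPolynomial.X 1) ww j) i
  simp only [AlgHom.toRingHom_eq_coe, RingHom.coe_coe, MvPolynomial.aeval_X] at h
  rw [GG, map_mul, map_mul, map_pow, MvPolynomial.aeval_X, MvPolynomial.aeval_X, h]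
  have : d i = ((d i).toNat : ℤ) := (Int.toNat_of_nonneg (D.hdpos i).le).symm
  conv_rhs => rw [this, zpow_natCast]
  rfl

theorem main_identity [Nonempty I] {θ : I → ℤ} {M : List I} {i0 : I} {star : I → I} {ww : List I}
    (D : Dat c d r) (W : W0 c d ww.reverse star) (H : Hi c d θ M i0)
    (hconn : ∀ i j : I, Relation.ReflTransGen (fun a b => a ≠ b ∧ c a b ≠ 0) i j)
    (hrmem : ∃ i, d i = r) (mu : I → I → KK)
    (hmu : ∀ i j, Bform c d (mu i) (alphaK j) = if i = j then 1 else 0)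
    (φ : KK →+* LL) (hφq : φ qv = qL) (hφt : φ tv = tL) (i j : I) :
    Pij c d ww mu i j =
        qv ^ (d j) * tv⁻¹ *
          ∑ u ∈ Finset.Icc (0 : ℤ) (r + ∑ k, θ k * d k),
            ∑ v ∈ Finset.Icc (0 : ℤ) (1 + ∑ k, θ k),
              ((dcoeff (φ ((Matrix.of (Cqt c d))⁻¹ i j)) u (-v) : ℚ) : KK) *
                qv ^ (-u) * tv ^ v := by
  obtain ⟨a, b, ha, hb, hT⟩ := W.main D H hconn hrmem
  rw [← ha, ← hb, Cqt_eq]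
  obtain ⟨hC, hS⟩ := inv_small D φ hφq hφt qv_sub
  set Ci := (Matrix.of (CF c d qv tv))⁻¹ with hCi
  have hT' : ∀ (p t : KK) (v : I → KK) i, Tl c d p t ww.reverse v i =
      -(p ^ a * t ^ b) * v (star i) := by
    intro p t v i
    rw [Tl_base _ hT]
    simp [MvPolynomial.aeval_X]
  have k1 : ∀ i, MvPolynomial.aeval ![qv⁻¹, tv] (GG c d ww i j) =
      Ci i j + (qv⁻¹ ^ a * tv ^ b) * Ci (star i) j := by
    intro i
    rw [GG_aeval D, inv_zpow']
    exact Ph_inv D qv tv qv_ne tv_ne qv_sub ww _ (hT' qv⁻¹ tv) Ci hC (W.dstar D) i j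
  have k2 : ∀ i, MvPolynomial.aeval ![qv, tv⁻¹] (GG c d ww i j) =
      Ci i j + (qv ^ a * tv⁻¹ ^ b) * Ci (star i) j := by
    intro i
    have h := Ph_inv D qv⁻¹ tv⁻¹ (inv_ne_zero qv_ne) (inv_ne_zero tv_ne)
      (by rw [inv_inv, ← neg_sub, neg_ne_zero]; exact qv_sub) ww (qv ^ a * tv⁻¹ ^ b)
      (by rw [inv_inv]; exact hT' qv tv⁻¹) Ci
      (by
        have e : CF c d qv⁻¹ tv⁻¹ = CF c d qv tv := by
          funext i j; exact CF_inv qv tv i j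
        rw [e]; exact hC) (W.dstar D) i j
    rw [inv_inv, inv_zpow', neg_neg] at h
    rw [GG_aeval D, h]
  have k3 := k1 (star i)
  rw [W.inv i] at k3
  have f := final φ hφq hφt (GG c d ww i j) (GG c d ww (star i) j) (Ci i j) (Ci (star i) j) a b
    k3 (k2 i) (hS _ _)
  rw [← f, Pij_eq D ww mu hmu, GG_aeval D, inv_zpow']
  have h3 : tv * tv⁻¹ = 1 := mul_inv_cancel₀ tv_ne
  linear_combination (-(qv ^ (d j) * qv ^ (-(d i)) * Ph c d qv⁻¹ tv ww j i)) * h3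

end part8

end S10

theorem statement_10
    {I : Type} [Fintype I] [DecidableEq I] [Nonempty I]
    (c : I → I → ℤ) (d : I → ℤ) (r : ℤ)
    -- `C` is a symmetrizable generalized Cartan matrix
    (hdiag : ∀ i, c i i = 2)
    (hoff : ∀ i j, i ≠ j → c i j ≤ 0)
    -- `(d_i)` are positive integers with gcd 1 symmetrizing `C`
    (hdpos : ∀ i, 0 < d i)
    (hgcd : Finset.univ.gcd d = 1)
    (hsymm : ∀ i j, d i * c i j = d j * c j i)
    -- each `d_i ∈ {1, r}` where `r = max_i d_i`
    (honer : ∀ i, d i = 1 ∨ d i = r)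
    (hrmax : ∀ i, d i ≤ r)
    (hrmem : ∃ i, d i = r)
    -- `d_i c_{ij} = -max(d_i, d_j)` whenever `i ≠ j` and `c_{ij} ≠ 0`
    (hbmax : ∀ i j, i ≠ j → c i j ≠ 0 → d i * c i j = -(max (d i) (d j)))
    -- `C` is indecomposable
    (hconn : ∀ i j : I, Relation.ReflTransGen (fun a b => a ≠ b ∧ c a b ≠ 0) i j)
    -- `C` is of finite type: the Weyl group is finite
    (hWfin : {w : (I → ℤ) → (I → ℤ) | memW c w}.Finite)
    -- `θ = Σ a_i α_i` is the highest root: `θ ∈ Φ` and `θ - β ∈ Q₊` for all `β ∈ Φ`;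
    -- then `h = 1 + Σ a_i` and `N = r + Σ a_i d_i = r h^∨`
    (θ : I → ℤ)
    (hθΦ : ∃ w, memW c w ∧ ∃ i, θ = w (alphaZ i))
    (hθhigh : ∀ β : I → ℤ, (∃ w, memW c w ∧ ∃ i, β = w (alphaZ i)) → ∀ k, β k ≤ θ k)
    -- `w₀` is the longest element: `w₀ ∈ W` with `w₀(α_i) ∈ -Q₊` for all `i`,
    -- and `i ↦ i^*` is the involution with `w₀(α_i) = -α_{i^*}`
    (w0 : (I → ℤ) → (I → ℤ))
    (hw0W : memW c w0)
    (hw0neg : ∀ i k, w0 (alphaZ i) k ≤ 0)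
    (istar : I → I)
    (hstar : ∀ i, w0 (alphaZ i) = -alphaZ (istar i))
    (hstarinv : Function.Involutive istar)
    -- `ww = (i₁, …, i_l)` is a reduced expression of `w₀`
    (ww : List I)
    (hred : (ww.map (sZ c)).foldr (· ∘ ·) id = w0)
    (hmin : ∀ vv : List I, (vv.map (sZ c)).foldr (· ∘ ·) id = w0 → ww.length ≤ vv.length)
    -- `μ_i` is the deformed fundamental coweight: `B(μ_i, α_j) = δ_{ij}`
    (mu : I → I → KK)
    (hmu : ∀ i j, Bform c d (mu i) (alphaK j) = if i = j then 1 else 0)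
    -- `φ` is the double Laurent expansion of `ℚ(q,t)`: first in `t⁻¹` (at `t = ∞`),
    -- then at `q = 0`; it is the unique ring homomorphism `ℚ(q,t) → ℚ((q))((t⁻¹))`
    -- sending `q`, `t` to their canonical images
    (φ : KK →+* LL)
    (hφq : φ qv = qL)
    (hφt : φ tv = tL)
    :
    ∀ i j : I,
      Pij c d ww mu i j =
        qv ^ (d j) * tv⁻¹ *
          ∑ u ∈ Finset.Icc (0 : ℤ) (r + ∑ k, θ k * d k),
            ∑ v ∈ Finset.Icc (0 : ℤ) (1 + ∑ k, θ k),
              ((dcoeff (φ ((Matrix.of (Cqt c d))⁻¹ i j)) u (-v) : ℚ) : KK) *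
                qv ^ (-u) * tv ^ v
    := by
  have D : S10.Dat c d r := ⟨hdiag, hoff, hdpos, hsymm, honer, hbmax, hWfin⟩
  have hw : w0 = ⇑(S10.Al c d ww.reverse) := by rw [← hred, S10.foldr_eq D]
  have W : S10.W0 c d ww.reverse istar := by
    refine ⟨?_, ?_, hstarinv⟩
    · intro L' hL'
      have := hmin L'.reverse (by rw [S10.foldr_eq D, List.reverse_reverse, hL', hw])
      simpa using this
    · intro i
      have := hstar i
      rw [hw] at this
      exact this
  obtain ⟨w, hwW, i0, hi0⟩ := hθΦ
  obtain ⟨M, hM⟩ := (S10.memW_iff D w).mp hwW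
  have H : S10.Hi c d θ M i0 := by
    refine ⟨?_, ?_⟩
    · rw [hi0, hM]; rfl
    · intro L i k
      exact hθhigh _ ⟨_, (S10.memW_iff D _).mpr ⟨L, rfl⟩, i, rfl⟩ k
  exact fun i j => S10.main_identity D W H hconn hrmem mu hmu φ hφq hφt i j
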